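/- arXiv:1807.06351 — 16 statements merged into one kernel-verified Lean document; each statement's English description precedes it below -/
import Mathlib

section
/- Let μ ∈ (0,1), and let ℓ₂ ∈ (1-μ, ∞) and ℓ₃ ∈ (-∞, -μ) be the unique critical points of u in these intervals. Let c be a real number with c < u(ℓ₂) and c < u(ℓ₃). Suppose x : ℝ → ℝ² ∖ {e,s} is smooth, T-periodic for some T > 0, satisfies the equations of motion x₁'' = 2x₂' - ∂V/∂q₁(x) and x₂'' = -2x₁' - ∂V/∂q₂(x), and x(t) lies in the bounded Hill's region 𝔎_c^b for all t. Then there exist t₀, t₁ ∈ [0, T) with t₀ ≠ t₁ such that x₂(t₀) = 0 and x₂(t₁) = 0; i.e., the orbit has at least two distinct syzygies during each period. -/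
open Real Set

/-- The effective potential of the planar circular restricted three-body problem
with mass ratio `μ`, where the earth sits at `e = (1-μ, 0)` and the sun at `s = (-μ, 0)`. -/
noncomputable def V (μ : ℝ) (q : ℝ × ℝ) : ℝ :=
  -μ / Real.sqrt ((q.1 - (1 - μ)) ^ 2 + q.2 ^ 2)
    - (1 - μ) / Real.sqrt ((q.1 + μ) ^ 2 + q.2 ^ 2)
    - (q.1 ^ 2 + q.2 ^ 2) / 2

/-- The restriction of the effective potential to the `q₁`-axis. -/
noncomputable def u (μ : ℝ) (x : ℝ) : ℝ :=
  -μ / |x - (1 - μ)| - (1 - μ) / |x + μ| - x ^ 2 / 2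

/-- Partial derivative `∂V/∂q₁`. -/
noncomputable def Vq1 (μ : ℝ) (q : ℝ × ℝ) : ℝ := deriv (fun a => V μ (a, q.2)) q.1

/-- Partial derivative `∂V/∂q₂`. -/
noncomputable def Vq2 (μ : ℝ) (q : ℝ × ℝ) : ℝ := deriv (fun b => V μ (q.1, b)) q.2

/-- Distance to the earth. -/
noncomputable def earthDist (μ : ℝ) (q : ℝ × ℝ) : ℝ := √((q.1 - (1 - μ)) ^ 2 + q.2 ^ 2)

/-- Distance to the sun. -/
noncomputable def sunDist (μ : ℝ) (q : ℝ × ℝ) : ℝ := √((q.1 + μ) ^ 2 + q.2 ^ 2)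

/-- The function `a ^ 3 * b ^ 3 * (m / a ^ 3 + n / b ^ 3 - 1)`, whose sign at the distances to the
primaries is the sign of `∂V/∂q₂` on the upper half-plane. -/
def verticalForce (m n a b : ℝ) : ℝ := m * b ^ 3 + n * a ^ 3 - a ^ 3 * b ^ 3

lemma V_eq_dist (μ : ℝ) (q : ℝ × ℝ) :
    V μ q = -(μ * (1 / earthDist μ q + earthDist μ q ^ 2 / 2))
      - (1 - μ) * (1 / sunDist μ q + sunDist μ q ^ 2 / 2) + μ * (1 - μ) / 2 := by
  have h1 : earthDist μ q ^ 2 = (q.1 - (1 - μ)) ^ 2 + q.2 ^ 2 := Real.sq_sqrt (by positivity)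
  have h2 : sunDist μ q ^ 2 = (q.1 + μ) ^ 2 + q.2 ^ 2 := Real.sq_sqrt (by positivity)
  rw [h1, h2, V, ← earthDist, ← sunDist]
  ring

lemma earthDist_axis (μ y : ℝ) : earthDist μ (y, 0) = |y - (1 - μ)| := by
  simp [earthDist, Real.sqrt_sq_eq_abs]

lemma sunDist_axis (μ y : ℝ) : sunDist μ (y, 0) = |y + μ| := by
  simp [sunDist, Real.sqrt_sq_eq_abs]

lemma u_eq_V (μ y : ℝ) : u μ y = V μ (y, 0) := by
  simp [u, V, Real.sqrt_sq_eq_abs]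

lemma earthDist_pos {μ : ℝ} {q : ℝ × ℝ} (h : q ≠ (1 - μ, 0)) : 0 < earthDist μ q := by
  apply Real.sqrt_pos.2
  by_contra hn
  exact h (Prod.ext (by simp only; nlinarith [sq_nonneg (q.1 - (1 - μ)), sq_nonneg q.2])
    (by simp only; nlinarith [sq_nonneg (q.1 - (1 - μ)), sq_nonneg q.2]))

lemma sunDist_pos {μ : ℝ} {q : ℝ × ℝ} (h : q ≠ (-μ, 0)) : 0 < sunDist μ q := by
  apply Real.sqrt_pos.2
  by_contra hn
  exact h (Prod.ext (by simp only; nlinarith [sq_nonneg (q.1 + μ), sq_nonneg q.2])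
    (by simp only; nlinarith [sq_nonneg (q.1 + μ), sq_nonneg q.2]))

lemma sunDist_le_earthDist_add_one (μ : ℝ) (q : ℝ × ℝ) :
    sunDist μ q ≤ earthDist μ q + 1 := by
  have h1 : earthDist μ q ^ 2 = (q.1 - (1 - μ)) ^ 2 + q.2 ^ 2 := Real.sq_sqrt (by positivity)
  have h0 : 0 ≤ earthDist μ q := Real.sqrt_nonneg _
  have h : q.1 - (1 - μ) ≤ earthDist μ q := Real.le_sqrt_of_sq_le (by nlinarith [sq_nonneg q.2])
  exact Real.sqrt_le_iff.2 ⟨by linarith, by nlinarith⟩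

lemma earthDist_le_sunDist_add_one (μ : ℝ) (q : ℝ × ℝ) :
    earthDist μ q ≤ sunDist μ q + 1 := by
  have h1 : sunDist μ q ^ 2 = (q.1 + μ) ^ 2 + q.2 ^ 2 := Real.sq_sqrt (by positivity)
  have h0 : 0 ≤ sunDist μ q := Real.sqrt_nonneg _
  have h : -(q.1 + μ) ≤ sunDist μ q := Real.le_sqrt_of_sq_le (by nlinarith [sq_nonneg q.2])
  exact Real.sqrt_le_iff.2 ⟨by linarith, by nlinarith⟩

lemma continuous_earthDist (μ : ℝ) : Continuous (earthDist μ) := by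
  unfold earthDist; fun_prop

lemma continuous_sunDist (μ : ℝ) : Continuous (sunDist μ) := by
  unfold sunDist; fun_prop

lemma verticalForce_comm (m n a b : ℝ) : verticalForce m n a b = verticalForce n m b a := by
  unfold verticalForce; ring

/-- At a collinear equilibrium beyond the primary of mass `m`, the vertical force is
attracting. -/
lemma verticalForce_pos_of_equilibrium {m n A : ℝ} (hn : 0 < n) (hmn : m + n = 1) (hA : 0 < A)
    (h : m / A ^ 2 + n / (A + 1) ^ 2 - (m * A + n * (A + 1)) = 0) :
    0 < verticalForce m n A (A + 1) := by
  have key : m * (A + 1) ^ 2 * (1 - A ^ 3) = n * A ^ 2 * ((A + 1) ^ 3 - 1) := by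
    field_simp at h
    linear_combination h
  have hB : 0 < (A + 1) ^ 3 - 1 := by ring_nf; positivity
  have hR : 0 < n * A ^ 2 * ((A + 1) ^ 3 - 1) := by positivity
  have : verticalForce m n A (A + 1) = n * A ^ 2 * ((A + 1) ^ 3 - 1) := by
    unfold verticalForce
    linear_combination (A + 1) * key + A ^ 3 * (A + 1) ^ 3 * hmn
  rwa [this]

lemma one_div_add_sq_anti {a b : ℝ} (ha : 0 < a) (hab : a ≤ b) (hb : b ≤ 1) :
    1 / b + b ^ 2 / 2 ≤ 1 / a + a ^ 2 / 2 := by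
  have hb0 : 0 < b := ha.trans_le hab
  have h : 1 / a + a ^ 2 / 2 - (1 / b + b ^ 2 / 2)
      = (b - a) * (2 - a * b * (a + b)) / (2 * a * b) := by
    field_simp; ring
  have h1 : a * b ≤ 1 := mul_le_one₀ (hab.trans hb) hb0.le hb
  have h2 : 0 ≤ 2 - a * b * (a + b) := by
    nlinarith [mul_le_mul h1 (by linarith : a + b ≤ 2) (by positivity) zero_le_one]
  have : 0 ≤ (b - a) * (2 - a * b * (a + b)) / (2 * a * b) :=
    div_nonneg (mul_nonneg (by linarith) h2) (by positivity)
  linarith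

lemma one_div_add_sq_mono {a b : ℝ} (ha : 1 ≤ a) (hab : a ≤ b) :
    1 / a + a ^ 2 / 2 ≤ 1 / b + b ^ 2 / 2 := by
  have ha0 : 0 < a := by linarith
  have hb0 : 0 < b := by linarith
  have h : 1 / b + b ^ 2 / 2 - (1 / a + a ^ 2 / 2)
      = (b - a) * (a * b * (a + b) - 2) / (2 * a * b) := by
    field_simp; ring
  have h1 : 1 ≤ a * b := one_le_mul_of_one_le_of_one_le ha (ha.trans hab)
  have h2 : 0 ≤ a * b * (a + b) - 2 := by
    nlinarith [mul_le_mul h1 (by linarith : 2 ≤ a + b) (by norm_num) (by positivity)]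
  have : 0 ≤ (b - a) * (a * b * (a + b) - 2) / (2 * a * b) :=
    div_nonneg (mul_nonneg (by linarith) h2) (by positivity)
  linarith

lemma verticalForce_neg {m n a b : ℝ} (hm : 0 < m) (hn : 0 < n) (hmn : m + n = 1)
    (ha : 1 ≤ a) (hb : 1 < b) : verticalForce m n a b < 0 := by
  have ha3 : 1 ≤ a ^ 3 := one_le_pow₀ ha
  have hb3 : 1 < b ^ 3 := one_lt_pow₀ hb (by norm_num)
  obtain rfl : n = 1 - m := by linarith
  unfold verticalForce
  nlinarith [mul_nonneg (mul_nonneg hm.le (sub_nonneg.2 ha3)) (by linarith : 0 ≤ b ^ 3),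
    mul_pos (mul_pos hn (sub_pos.2 hb3)) (by linarith : 0 < a ^ 3)]

/-- If the vertical force vanishes at a point where the farther primary is no farther than at a
place with attracting vertical force, then the nearer primary is no nearer. -/
lemma le_of_verticalForce_eq_zero {m n a b A B : ℝ} (hm : 0 < m) (hn : 0 < n)
    (ha : 0 < a) (hb : 0 < b) (hA : 0 < A) (hB : 0 < B) (hbB : b ≤ B)
    (h : verticalForce m n a b = 0) (hP : 0 < verticalForce m n A B) : A ≤ a := by
  by_contra! hlt
  have h1 : m / a ^ 3 + n / b ^ 3 = 1 := by
    unfold verticalForce at h; field_simp; linarith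
  have h2 : 1 < m / A ^ 3 + n / B ^ 3 := by
    rw [div_add_div _ _ (by positivity) (by positivity), one_lt_div (by positivity)]
    unfold verticalForce at hP; linarith
  have h3 : m / A ^ 3 ≤ m / a ^ 3 := by gcongr
  have h4 : n / B ^ 3 ≤ n / b ^ 3 := by gcongr
  linarith

lemma verticalForce_pos {m n a b : ℝ} (hm : 0 < m) (hn : 0 < n) (hmn : m + n = 1)
    (ha : 0 < a) (hb : 0 < b) (ha1 : a < 1) (hb1 : b < 1) : 0 < verticalForce m n a b := by
  have ha3 : a ^ 3 < 1 := pow_lt_one₀ ha.le ha1 (by norm_num)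
  have hb3 : b ^ 3 < 1 := pow_lt_one₀ hb.le hb1 (by norm_num)
  have h : verticalForce m n a b = m * b ^ 3 * (1 - a ^ 3) + n * a ^ 3 * (1 - b ^ 3) := by
    unfold verticalForce
    linear_combination a ^ 3 * b ^ 3 * hmn
  have h1 : 0 < m * b ^ 3 * (1 - a ^ 3) := mul_pos (by positivity) (by linarith)
  have h2 : 0 < n * a ^ 3 * (1 - b ^ 3) := mul_pos (by positivity) (by linarith)
  linarith

/-- On the boundary of the region where the vertical force is attracting and the farther primary
is closer than at the collinear equilibrium, the potential is at least its equilibrium value. -/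
lemma dist_potential_le_of_boundary {m n a b A : ℝ} (hm : 0 < m) (hn : 0 < n) (hmn : m + n = 1)
    (hA : 0 < A) (hP : 0 < verticalForce m n A (A + 1))
    (ha : 0 < a) (hb1 : 1 ≤ b) (hba : b ≤ a + 1) (hbA : b ≤ A + 1)
    (hf : 0 ≤ verticalForce m n a b) (h : b = A + 1 ∨ verticalForce m n a b = 0) :
    m * (1 / a + a ^ 2 / 2) + n * (1 / b + b ^ 2 / 2)
      ≤ m * (1 / A + A ^ 2 / 2) + n * (1 / (A + 1) + (A + 1) ^ 2 / 2) := by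
  have ha1 : a ≤ 1 := by
    by_contra! ha1
    rw [verticalForce_comm] at hf
    exact absurd hf (not_le.2 (verticalForce_neg hn hm (by linarith) hb1 ha1))
  have hAa : A ≤ a := by
    rcases h with h | h
    · linarith
    · exact le_of_verticalForce_eq_zero hm hn ha (by linarith) hA (by linarith) hbA h hP
  have h1 := one_div_add_sq_anti hA hAa ha1
  have h2 := one_div_add_sq_mono hb1 hbA
  gcongr

/-- A collinear equilibrium on the earth's side, described through its distance to the earth. -/
lemma equilibrium_earth_side {μ l : ℝ} (hl : 1 - μ < l) (hμ : -μ < l) (h : deriv (u μ) l = 0) :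
    μ / (l - (1 - μ)) ^ 2 + (1 - μ) / (l - (1 - μ) + 1) ^ 2
      - (μ * (l - (1 - μ)) + (1 - μ) * (l - (1 - μ) + 1)) = 0 := by
  have h1 : l - (1 - μ) ≠ 0 := by linarith
  have h2 : l + μ ≠ 0 := by linarith
  have heq : u μ =ᶠ[nhds l] fun y => -μ / (y - (1 - μ)) - (1 - μ) / (y + μ) - y ^ 2 / 2 := by
    filter_upwards [lt_mem_nhds hl, lt_mem_nhds hμ] with y hy hy'
    rw [u, abs_of_pos (by linarith), abs_of_pos (by linarith)]
  have hd : HasDerivAt (fun y => -μ / (y - (1 - μ)) - (1 - μ) / (y + μ) - y ^ 2 / 2)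
      (μ / (l - (1 - μ)) ^ 2 + (1 - μ) / (l + μ) ^ 2 - l) l := by
    have d1 := (hasDerivAt_const l (-μ)).div ((hasDerivAt_id l).sub_const (1 - μ)) h1
    have d2 := (hasDerivAt_const l (1 - μ)).div ((hasDerivAt_id l).add_const μ) h2
    have d3 := ((hasDerivAt_id l).pow 2).div_const 2
    refine ((d1.sub d2).sub d3).congr_deriv ?_
    simp
    ring
  rw [heq.deriv_eq, hd.deriv] at h
  rw [← h, show l - (1 - μ) + 1 = l + μ by ring]
  ring

/-- A collinear equilibrium on the sun's side, described through its distance to the sun. -/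
lemma equilibrium_sun_side {μ l : ℝ} (hl : l < 1 - μ) (hμ : l < -μ) (h : deriv (u μ) l = 0) :
    (1 - μ) / (-(l + μ)) ^ 2 + μ / (-(l + μ) + 1) ^ 2
      - ((1 - μ) * (-(l + μ)) + μ * (-(l + μ) + 1)) = 0 := by
  have h1 : l - (1 - μ) ≠ 0 := by linarith
  have h2 : l + μ ≠ 0 := by linarith
  have heq : u μ =ᶠ[nhds l] fun y => μ / (y - (1 - μ)) + (1 - μ) / (y + μ) - y ^ 2 / 2 := by
    filter_upwards [gt_mem_nhds hl, gt_mem_nhds hμ] with y hy hy'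
    rw [u, abs_of_neg (by linarith), abs_of_neg (by linarith), neg_div_neg_eq, div_neg]
    ring
  have hd : HasDerivAt (fun y => μ / (y - (1 - μ)) + (1 - μ) / (y + μ) - y ^ 2 / 2)
      (-μ / (l - (1 - μ)) ^ 2 - (1 - μ) / (l + μ) ^ 2 - l) l := by
    have d1 := (hasDerivAt_const l μ).div ((hasDerivAt_id l).sub_const (1 - μ)) h1
    have d2 := (hasDerivAt_const l (1 - μ)).div ((hasDerivAt_id l).add_const μ) h2
    have d3 := ((hasDerivAt_id l).pow 2).div_const 2
    refine ((d1.add d2).sub d3).congr_deriv ?_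
    simp
    ring
  rw [heq.deriv_eq, hd.deriv] at h
  rw [show -(l + μ) + 1 = -(l - (1 - μ)) by ring, neg_sq, neg_sq]
  linear_combination -h

lemma Vq2_eq {μ : ℝ} {q : ℝ × ℝ} (h1 : q ≠ (1 - μ, 0)) (h2 : q ≠ (-μ, 0)) :
    Vq2 μ q = q.2 * (verticalForce μ (1 - μ) (earthDist μ q) (sunDist μ q)
      / (earthDist μ q ^ 3 * sunDist μ q ^ 3)) := by
  have p1 := earthDist_pos h1
  have p2 := sunDist_pos h2
  have key : ∀ a : ℝ, 0 < √(a ^ 2 + q.2 ^ 2) →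
      HasDerivAt (fun b : ℝ => √(a ^ 2 + b ^ 2)) (q.2 / √(a ^ 2 + q.2 ^ 2)) q.2 := by
    intro a ha
    have hs : HasDerivAt (fun b : ℝ => a ^ 2 + b ^ 2) (2 * q.2) q.2 := by
      simpa using ((hasDerivAt_id q.2).pow 2).const_add (a ^ 2)
    convert hs.sqrt (Real.sqrt_pos.1 ha).ne' using 1
    field_simp
  have d1 := (hasDerivAt_const q.2 (-μ)).div (key _ p1) p1.ne'
  have d2 := (hasDerivAt_const q.2 (1 - μ)).div (key _ p2) p2.ne'
  have d3 : HasDerivAt (fun b : ℝ => (q.1 ^ 2 + b ^ 2) / 2) q.2 q.2 := by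
    refine ((((hasDerivAt_id q.2).pow 2).const_add (q.1 ^ 2)).div_const 2).congr_deriv ?_
    simp
  have hd := ((d1.sub d2).sub d3).deriv
  rw [← earthDist, ← sunDist] at hd
  refine Eq.trans hd ?_
  unfold verticalForce
  field_simp
  ring

/-- The region around the primaries that confines the bounded Hill's region. -/
def attractingRegion (μ ℓ₂ ℓ₃ : ℝ) : Set (ℝ × ℝ) :=
  {q | 0 < verticalForce μ (1 - μ) (earthDist μ q) (sunDist μ q) ∧
    sunDist μ q < ℓ₂ + μ ∧ earthDist μ q < 1 - μ - ℓ₃}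

lemma continuous_verticalForce (μ : ℝ) :
    Continuous fun q => verticalForce μ (1 - μ) (earthDist μ q) (sunDist μ q) := by
  have := continuous_earthDist μ
  have := continuous_sunDist μ
  unfold verticalForce
  fun_prop

lemma isOpen_attractingRegion (μ ℓ₂ ℓ₃ : ℝ) : IsOpen (attractingRegion μ ℓ₂ ℓ₃) :=
  (isOpen_lt continuous_const (continuous_verticalForce μ)).inter
    ((isOpen_lt (continuous_sunDist μ) continuous_const).inter
      (isOpen_lt (continuous_earthDist μ) continuous_const))

lemma closure_attractingRegion_subset (μ ℓ₂ ℓ₃ : ℝ) :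
    closure (attractingRegion μ ℓ₂ ℓ₃) ⊆
      {q | 0 ≤ verticalForce μ (1 - μ) (earthDist μ q) (sunDist μ q) ∧
        sunDist μ q ≤ ℓ₂ + μ ∧ earthDist μ q ≤ 1 - μ - ℓ₃} :=
  closure_minimal (fun _ hq => ⟨hq.1.le, hq.2.1.le, hq.2.2.le⟩)
    ((isClosed_le continuous_const (continuous_verticalForce μ)).inter
      ((isClosed_le (continuous_sunDist μ) continuous_const).inter
        (isClosed_le (continuous_earthDist μ) continuous_const)))

lemma earth_mem_attractingRegion {μ ℓ₂ ℓ₃ : ℝ} (hμ : μ ∈ Ioo (0 : ℝ) 1) (hℓ₂ : 1 - μ < ℓ₂)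
    (hℓ₃ : ℓ₃ < -μ) : ((1 - μ, 0) : ℝ × ℝ) ∈ attractingRegion μ ℓ₂ ℓ₃ := by
  obtain ⟨h0, h1⟩ := hμ
  simp only [attractingRegion, mem_ofPred_eq, earthDist_axis, sunDist_axis, verticalForce]
  norm_num
  exact ⟨h0, by linarith, by linarith⟩

lemma sun_mem_attractingRegion {μ ℓ₂ ℓ₃ : ℝ} (hμ : μ ∈ Ioo (0 : ℝ) 1) (hℓ₂ : 1 - μ < ℓ₂)
    (hℓ₃ : ℓ₃ < -μ) : ((-μ, 0) : ℝ × ℝ) ∈ attractingRegion μ ℓ₂ ℓ₃ := by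
  obtain ⟨h0, h1⟩ := hμ
  simp only [attractingRegion, mem_ofPred_eq, earthDist_axis, sunDist_axis, verticalForce]
  rw [show -μ - (1 - μ) = -1 by ring]
  norm_num
  exact ⟨h1, by linarith, by linarith⟩

/-- On the boundary of the attracting region the potential is at least one of its values at the
two outer collinear equilibria. -/
lemma mem_attractingRegion_of_mem_closure {μ ℓ₂ ℓ₃ c : ℝ} (hμ : μ ∈ Ioo (0 : ℝ) 1)
    (hℓ₂ : 1 - μ < ℓ₂) (hℓ₃ : ℓ₃ < -μ) (hcrit₂ : deriv (u μ) ℓ₂ = 0)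
    (hcrit₃ : deriv (u μ) ℓ₃ = 0) (hc₂ : c < u μ ℓ₂) (hc₃ : c < u μ ℓ₃) {q : ℝ × ℝ}
    (h1 : q ≠ (1 - μ, 0)) (h2 : q ≠ (-μ, 0)) (hV : V μ q ≤ c)
    (hq : q ∈ closure (attractingRegion μ ℓ₂ ℓ₃)) : q ∈ attractingRegion μ ℓ₂ ℓ₃ := by
  obtain ⟨hμ0, hμ1⟩ := hμ
  have hn : 0 < 1 - μ := by linarith
  obtain ⟨hf, hs, he⟩ := closure_attractingRegion_subset μ ℓ₂ ℓ₃ hq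
  have pe := earthDist_pos h1
  have ps := sunDist_pos h2
  have hA : 0 < ℓ₂ - (1 - μ) := by linarith
  have hB : 0 < -(ℓ₃ + μ) := by linarith
  have hAP := verticalForce_pos_of_equilibrium hn (by ring) hA
    (equilibrium_earth_side hℓ₂ (by linarith) hcrit₂)
  have hBP := verticalForce_pos_of_equilibrium hμ0 (by ring) hB
    (equilibrium_sun_side (by linarith) hℓ₃ hcrit₃)
  rw [V_eq_dist] at hV
  rw [u_eq_V, V_eq_dist, earthDist_axis, sunDist_axis, abs_of_pos hA, abs_of_pos (by linarith),
    show ℓ₂ + μ = ℓ₂ - (1 - μ) + 1 by ring] at hc₂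
  rw [u_eq_V, V_eq_dist, earthDist_axis, sunDist_axis, abs_of_neg (by linarith),
    abs_of_neg (by linarith), show -(ℓ₃ - (1 - μ)) = -(ℓ₃ + μ) + 1 by ring] at hc₃
  have earth_side : 1 ≤ sunDist μ q →
      ¬(sunDist μ q = ℓ₂ - (1 - μ) + 1 ∨
        verticalForce μ (1 - μ) (earthDist μ q) (sunDist μ q) = 0) := by
    intro hb h
    have := dist_potential_le_of_boundary hμ0 hn (by ring) hA hAP pe hb
      (sunDist_le_earthDist_add_one μ q) (by linarith) hf h
    linarith
  rw [verticalForce_comm] at hf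
  have sun_side : 1 ≤ earthDist μ q →
      ¬(earthDist μ q = -(ℓ₃ + μ) + 1 ∨
        verticalForce (1 - μ) μ (sunDist μ q) (earthDist μ q) = 0) := by
    intro hb h
    have := dist_potential_le_of_boundary hn hμ0 (by ring) hB hBP ps hb
      (earthDist_le_sunDist_add_one μ q) (by linarith) hf h
    linarith
  rw [verticalForce_comm] at hf
  refine ⟨lt_of_le_of_ne hf fun h => ?_, lt_of_le_of_ne hs fun h => ?_,
    lt_of_le_of_ne he fun h => ?_⟩
  · rcases le_or_gt 1 (sunDist μ q) with hb | hb
    · exact earth_side hb (Or.inr h.symm)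
    rcases le_or_gt 1 (earthDist μ q) with ha | ha
    · exact sun_side ha (Or.inr (by rw [verticalForce_comm]; exact h.symm))
    · exact (verticalForce_pos hμ0 hn (by ring) pe ps ha hb).ne h
  · exact earth_side (by linarith) (Or.inl (by linarith))
  · exact sun_side (by linarith) (Or.inl (by linarith))

/-- If `y` has no zero in an open interval of length `T` and `f` is positive, then `-(y * f)` is not
the derivative of a `T`-periodic function. -/
lemma false_of_periodic_deriv {y w f : ℝ → ℝ} {a T : ℝ} (hT : 0 < T) (hy : Continuous y)
    (hw : Differentiable ℝ w) (hwT : Function.Periodic w T) (hf : ∀ t, 0 < f t)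
    (hd : ∀ t, deriv w t = -(y t * f t)) (hne : ∀ t ∈ Ioo a (a + T), y t ≠ 0) : False := by
  have ha : a ∈ Icc a (a + T) := ⟨le_rfl, by linarith⟩
  have hb : a + T ∈ Icc a (a + T) := ⟨by linarith, le_rfl⟩
  have hsign : (∀ t ∈ Ioo a (a + T), 0 < y t) ∨ ∀ t ∈ Ioo a (a + T), y t < 0 := by
    by_contra! hcon
    obtain ⟨⟨s, hs, hs'⟩, t, ht, ht'⟩ := hcon
    obtain ⟨r, hr, hr'⟩ := isPreconnected_Ioo.intermediate_value hs ht hy.continuousOn ⟨hs', ht'⟩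
    exact hne r hr hr'
  rcases hsign with hpos | hneg
  · have := strictAntiOn_of_deriv_neg (convex_Icc a (a + T)) hw.continuous.continuousOn
      (fun t ht => by
        rw [interior_Icc] at ht
        rw [hd]
        exact neg_neg_of_pos (mul_pos (hpos t ht) (hf t))) ha hb (by linarith)
    exact this.ne (hwT a)
  · have := strictMonoOn_of_deriv_pos (convex_Icc a (a + T)) hw.continuous.continuousOn
      (fun t ht => by
        rw [interior_Icc] at ht
        rw [hd]
        exact neg_pos_of_neg (mul_neg_of_neg_of_pos (hneg t ht) (hf t))) ha hb (by linarith)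
    exact this.ne' (hwT a)

/-- A periodic function with at most one zero in `[0, T)` is zero-free on an open period
interval. -/
lemma exists_Ioo_ne_zero_of_periodic {y : ℝ → ℝ} {T : ℝ} (hy : Function.Periodic y T)
    (h : ∀ s ∈ Ico (0 : ℝ) T, ∀ t ∈ Ico (0 : ℝ) T, y s = 0 → y t = 0 → s = t) :
    ∃ a, ∀ t ∈ Ioo a (a + T), y t ≠ 0 := by
  by_cases hz : ∃ z ∈ Ico (0 : ℝ) T, y z = 0
  · obtain ⟨z, hz, hyz⟩ := hz
    refine ⟨z, fun t ht hyt => ?_⟩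
    rcases lt_or_ge t T with htT | htT
    · exact ht.1.ne (h z hz t ⟨hz.1.trans ht.1.le, htT⟩ hyz hyt)
    · have := h z hz (t - T) ⟨by linarith, by linarith [ht.2, hz.2]⟩ hyz (by rw [hy.sub_eq, hyt])
      linarith [ht.2]
  · push Not at hz
    exact ⟨0, fun t ht => hz t ⟨ht.1.le, by linarith [ht.2]⟩⟩

/-- Every periodic orbit inside the bounded Hill's region, for an energy below the second
critical value, has at least two distinct syzygies during each period. -/
theorem syzygies_of_periodic_orbit
    (μ : ℝ) (hμ : μ ∈ Ioo (0 : ℝ) 1)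
    (ℓ₂ ℓ₃ : ℝ) (hℓ₂ : ℓ₂ ∈ Ioi (1 - μ)) (hℓ₃ : ℓ₃ ∈ Iio (-μ))
    (hcrit₂ : deriv (u μ) ℓ₂ = 0)
    (huniq₂ : ∀ x ∈ Ioi (1 - μ), deriv (u μ) x = 0 → x = ℓ₂)
    (hcrit₃ : deriv (u μ) ℓ₃ = 0)
    (huniq₃ : ∀ x ∈ Iio (-μ), deriv (u μ) x = 0 → x = ℓ₃)
    (c : ℝ) (hc₂ : c < u μ ℓ₂) (hc₃ : c < u μ ℓ₃)
    -- `K` is the bounded Hill's region `𝔎_c^b`: a connected component of the Hill's region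
    -- whose closure contains one of the primaries
    (K : Set (ℝ × ℝ)) (p : ℝ × ℝ)
    (hK : K = connectedComponentIn
      {q : ℝ × ℝ | q ≠ (1 - μ, 0) ∧ q ≠ (-μ, 0) ∧ V μ q ≤ c} p)
    (hKbdd : ((1 - μ, 0) : ℝ × ℝ) ∈ closure K ∨ ((-μ, 0) : ℝ × ℝ) ∈ closure K)
    -- the periodic orbit
    (x : ℝ → ℝ × ℝ) (hsmooth : ContDiff ℝ (⊤ : ℕ∞) x)
    (T : ℝ) (hT : 0 < T) (hper : Function.Periodic x T)
    (heom1 : ∀ t, deriv (deriv fun s => (x s).1) t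
      = 2 * deriv (fun s => (x s).2) t - Vq1 μ (x t))
    (heom2 : ∀ t, deriv (deriv fun s => (x s).2) t
      = -2 * deriv (fun s => (x s).1) t - Vq2 μ (x t))
    (hxK : ∀ t, x t ∈ K) :
    ∃ t₀ ∈ Ico (0 : ℝ) T, ∃ t₁ ∈ Ico (0 : ℝ) T,
      t₀ ≠ t₁ ∧ (x t₀).2 = 0 ∧ (x t₁).2 = 0 := by
  by_contra hcon
  set H : Set (ℝ × ℝ) := {q | q ≠ (1 - μ, 0) ∧ q ≠ (-μ, 0) ∧ V μ q ≤ c}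
  have hKH : K ⊆ H := hK ▸ connectedComponentIn_subset H p
  have hopen := isOpen_attractingRegion μ ℓ₂ ℓ₃
  have hmeet : (K ∩ attractingRegion μ ℓ₂ ℓ₃).Nonempty := by
    rw [inter_comm]
    rcases hKbdd with h | h
    · exact mem_closure_iff.1 h _ hopen (earth_mem_attractingRegion hμ hℓ₂ hℓ₃)
    · exact mem_closure_iff.1 h _ hopen (sun_mem_attractingRegion hμ hℓ₂ hℓ₃)
  have hKpre : IsPreconnected K := hK ▸ isPreconnected_connectedComponentIn
  have hsub : K ⊆ attractingRegion μ ℓ₂ ℓ₃ :=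
    hKpre.subset_of_closure_inter_subset hopen hmeet fun q hq =>
      mem_attractingRegion_of_mem_closure hμ hℓ₂ hℓ₃ hcrit₂ hcrit₃ hc₂ hc₃
        (hKH hq.2).1 (hKH hq.2).2.1 (hKH hq.2).2.2 hq.1
  have hx1 : ContDiff ℝ (⊤ : ℕ∞) fun s => (x s).1 := hsmooth.fst
  have hx2 : ContDiff ℝ (⊤ : ℕ∞) fun s => (x s).2 := hsmooth.snd
  have hd1 : Differentiable ℝ fun s => (x s).1 := hx1.differentiable (by simp)
  have hd2 : Differentiable ℝ (deriv fun s => (x s).2) :=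
    (contDiff_infty_iff_deriv.1 hx2).2.differentiable (by simp)
  have hper2 : Function.Periodic (fun s => (x s).2) T := fun t => by simp [hper t]
  have hper2' : Function.Periodic (deriv fun s => (x s).2) T := fun t => by
    rw [← deriv_comp_add_const, funext hper2]
  obtain ⟨a, ha⟩ := exists_Ioo_ne_zero_of_periodic hper2 fun s hs t ht hys hyt => by
    by_contra hst
    exact hcon ⟨s, hs, t, ht, hst, hys, hyt⟩
  refine false_of_periodic_deriv hT hx2.continuous (hd2.add (hd1.const_mul 2))
    (fun t => ?_) (fun t => ?_) (fun t => ?_) ha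
    (f := fun t => verticalForce μ (1 - μ) (earthDist μ (x t)) (sunDist μ (x t))
      / (earthDist μ (x t) ^ 3 * sunDist μ (x t) ^ 3))
  · simp [hper2' t, hper t]
  · have h := hKH (hxK t)
    exact div_pos (hsub (hxK t)).1
      (mul_pos (pow_pos (earthDist_pos h.1) 3) (pow_pos (sunDist_pos h.2.1) 3))
  · have h := hKH (hxK t)
    rw [deriv_add (hd2 t) ((hd1 t).const_mul 2), deriv_const_mul 2 (hd1 t), heom2,
      Vq2_eq h.1 h.2.1]
    ring
end

section
/- Let μ ∈ (0,1), let Θ = {(σ,ρ) ∈ ℝ² : σ > 0, ρ > 0, σ + ρ > 1, |σ - ρ| < 1}, and let U(σ,ρ) = ((1-μ)σ² + μρ²)/2 + μ/ρ + (1-μ)/σ. Then (1,1) is the unique critical point of U in Θ, its Hessian at (1,1) is the diagonal matrix diag(3(1-μ), 3μ), and (1,1) is a strict local minimum of U. -/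
open Real Set Filter

/-- The effective potential of the PCR3BP in the distance coordinates
`(σ, ρ) = (‖q-s‖, ‖q-e‖)` of the upper half-plane. -/
noncomputable def U (μ : ℝ) (p : ℝ × ℝ) : ℝ :=
  ((1 - μ) * p.1 ^ 2 + μ * p.2 ^ 2) / 2 + μ / p.2 + (1 - μ) / p.1

/-- The image of the upper half-plane under `q ↦ (‖q-s‖, ‖q-e‖)`:
the open diagonal half-strip in the first quadrant. -/
def Theta : Set (ℝ × ℝ) :=
  {p | 0 < p.1 ∧ 0 < p.2 ∧ 1 < p.1 + p.2 ∧ |p.1 - p.2| < 1}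

/-- The one-variable profile `x ↦ x² / 2 + 1 / x`, of which `U` is a convex combination. -/
noncomputable def radialPotential (x : ℝ) : ℝ := x ^ 2 / 2 + x⁻¹

lemma U_eq_radialPotential (μ : ℝ) (p : ℝ × ℝ) :
    U μ p = (1 - μ) * radialPotential p.1 + μ * radialPotential p.2 := by
  simp only [U, radialPotential, div_eq_mul_inv]
  ring

lemma hasDerivAt_radialPotential {x : ℝ} (hx : x ≠ 0) :
    HasDerivAt radialPotential (x - (x ^ 2)⁻¹) x := by
  have h := ((hasDerivAt_pow 2 x).div_const 2).add (hasDerivAt_inv hx)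
  exact h.congr_deriv (by norm_num; ring)

lemma deriv_deriv_radialPotential_one : deriv (deriv radialPotential) 1 = 3 := by
  have h : deriv radialPotential =ᶠ[nhds 1] fun x => x - (x ^ 2)⁻¹ := by
    filter_upwards [isOpen_ne.mem_nhds (one_ne_zero (α := ℝ))] with x hx
    exact (hasDerivAt_radialPotential hx).deriv
  rw [h.deriv_eq]
  have h' := (hasDerivAt_id (1 : ℝ)).sub ((hasDerivAt_pow 2 (1 : ℝ)).inv (by norm_num))
  exact (h'.congr_deriv (by norm_num)).deriv

lemma eq_one_of_sub_inv_sq_eq_zero {x : ℝ} (hx : 0 < x) (h : x - (x ^ 2)⁻¹ = 0) : x = 1 := by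
  have h3 : x ^ 3 = 1 := by
    field_simp at h
    linarith
  exact (pow_eq_one_iff_of_nonneg hx.le three_ne_zero).mp h3

lemma radialPotential_sub_one {x : ℝ} (hx : x ≠ 0) :
    radialPotential x - radialPotential 1 = (x - 1) ^ 2 * (x + 2) / (2 * x) := by
  simp only [radialPotential]
  field_simp
  ring

lemma radialPotential_one_le {x : ℝ} (hx : 0 < x) : radialPotential 1 ≤ radialPotential x := by
  rw [← sub_nonneg, radialPotential_sub_one hx.ne']
  positivity

lemma radialPotential_one_lt {x : ℝ} (hx : 0 < x) (hx1 : x ≠ 1) :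
    radialPotential 1 < radialPotential x := by
  have := sub_ne_zero.mpr hx1
  rw [← sub_pos, radialPotential_sub_one hx.ne']
  positivity

lemma hasFDerivAt_U (μ : ℝ) {p : ℝ × ℝ} (h1 : p.1 ≠ 0) (h2 : p.2 ≠ 0) :
    HasFDerivAt (U μ)
      (((1 - μ) * (p.1 - (p.1 ^ 2)⁻¹)) • ContinuousLinearMap.fst ℝ ℝ ℝ
        + (μ * (p.2 - (p.2 ^ 2)⁻¹)) • ContinuousLinearMap.snd ℝ ℝ ℝ) p := by
  rw [funext (U_eq_radialPotential μ)]
  simp only [mul_smul]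
  exact (((hasDerivAt_radialPotential h1).comp_hasFDerivAt p hasFDerivAt_fst).const_mul _).add
    (((hasDerivAt_radialPotential h2).comp_hasFDerivAt p hasFDerivAt_snd).const_mul _)

lemma U_one_one_lt {μ : ℝ} (hμ : μ ∈ Ioo (0 : ℝ) 1) {p : ℝ × ℝ} (h1 : 0 < p.1) (h2 : 0 < p.2)
    (hp : p ≠ (1, 1)) : U μ (1, 1) < U μ p := by
  have hμ0 := hμ.1
  have hμ1 : 0 < 1 - μ := sub_pos.mpr hμ.2
  simp only [U_eq_radialPotential]
  by_cases hσ : p.1 = 1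
  · have hρ : p.2 ≠ 1 := fun hρ => hp (Prod.ext hσ hρ)
    exact add_lt_add_of_le_of_lt
      (mul_le_mul_of_nonneg_left (radialPotential_one_le h1) hμ1.le)
      (mul_lt_mul_of_pos_left (radialPotential_one_lt h2 hρ) hμ0)
  · exact add_lt_add_of_lt_of_le
      (mul_lt_mul_of_pos_left (radialPotential_one_lt h1 hσ) hμ1)
      (mul_le_mul_of_nonneg_left (radialPotential_one_le h2) hμ0.le)

/-- `(1,1)` is the unique critical point of `U` in `Θ`, its Hessian there is
`diag(3(1-μ), 3μ)`, and it is a strict local minimum. -/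
theorem U_unique_critical_point (μ : ℝ) (hμ : μ ∈ Ioo (0 : ℝ) 1) :
    (((1 : ℝ), (1 : ℝ)) ∈ Theta
      ∧ fderiv ℝ (U μ) (1, 1) = 0
      ∧ ∀ p ∈ Theta, fderiv ℝ (U μ) p = 0 → p = (1, 1))
    ∧ (deriv (deriv fun σ => U μ (σ, 1)) 1 = 3 * (1 - μ)
      ∧ deriv (deriv fun ρ => U μ (1, ρ)) 1 = 3 * μ
      ∧ deriv (fun σ => deriv (fun ρ => U μ (σ, ρ)) 1) 1 = 0)
    ∧ (∀ᶠ p in nhdsWithin ((1 : ℝ), (1 : ℝ)) {((1 : ℝ), (1 : ℝ))}ᶜ,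
        U μ (1, 1) < U μ p) := by
  refine ⟨⟨by norm_num [Theta], ?_, ?_⟩, ⟨?_, ?_, ?_⟩, ?_⟩
  · rw [(hasFDerivAt_U μ (p := (1, 1)) one_ne_zero one_ne_zero).fderiv]
    simp
  · rintro ⟨σ, ρ⟩ ⟨hσ, hρ, -, -⟩ h
    rw [(hasFDerivAt_U μ hσ.ne' hρ.ne').fderiv] at h
    have h1 : (1 - μ) * (σ - (σ ^ 2)⁻¹) = 0 := by
      simpa using congrArg (fun L : ℝ × ℝ →L[ℝ] ℝ => L (1, 0)) h
    have h2 : μ * (ρ - (ρ ^ 2)⁻¹) = 0 := by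
      simpa using congrArg (fun L : ℝ × ℝ →L[ℝ] ℝ => L (0, 1)) h
    exact Prod.ext
      (eq_one_of_sub_inv_sq_eq_zero hσ
        ((mul_eq_zero.mp h1).resolve_left (sub_pos.mpr hμ.2).ne'))
      (eq_one_of_sub_inv_sq_eq_zero hρ ((mul_eq_zero.mp h2).resolve_left hμ.1.ne'))
  · have h : (deriv fun σ => U μ (σ, 1)) = fun σ => (1 - μ) * deriv radialPotential σ := by
      funext σ
      simp only [U_eq_radialPotential, deriv_add_const, deriv_const_mul_field]
    rw [h, deriv_const_mul_field, deriv_deriv_radialPotential_one, mul_comm]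
  · have h : (deriv fun ρ => U μ (1, ρ)) = fun ρ => μ * deriv radialPotential ρ := by
      funext ρ
      simp only [U_eq_radialPotential, deriv_const_add, deriv_const_mul_field]
    rw [h, deriv_const_mul_field, deriv_deriv_radialPotential_one, mul_comm]
  · simp only [U_eq_radialPotential, deriv_const_add, deriv_const]
  · have h1 : ∀ᶠ p : ℝ × ℝ in nhds (1, 1), 0 < p.1 :=
      continuous_fst.continuousAt.eventually (lt_mem_nhds one_pos)
    have h2 : ∀ᶠ p : ℝ × ℝ in nhds (1, 1), 0 < p.2 :=
      continuous_snd.continuousAt.eventually (lt_mem_nhds one_pos)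
    filter_upwards [mem_nhdsWithin_of_mem_nhds h1, mem_nhdsWithin_of_mem_nhds h2,
      self_mem_nhdsWithin] with p hσ hρ hp
    exact U_one_one_lt hμ hσ hρ hp
end

section
/- Let μ ∈ (0,1). The points ℓ₄ = (1/2 - μ, √3/2) and ℓ₅ = (1/2 - μ, -√3/2) are critical points of V with V(ℓ₄) = V(ℓ₅) = (μ(1-μ) - 3)/2, and for every q ∈ ℝ² ∖ {e, s} with q ∉ {ℓ₄, ℓ₅} one has V(q) < (μ(1-μ) - 3)/2; i.e., ℓ₄ and ℓ₅ are the global maxima of the effective potential. -/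
open Real Set

lemma three_halves_le_inv_add_sq {r : ℝ} (hr : 0 < r) : 3 / 2 ≤ 1 / r + r ^ 2 / 2 := by
  have h : 1 / r + r ^ 2 / 2 - 3 / 2 = (r - 1) ^ 2 * (r + 2) / (2 * r) := by
    field_simp
    ring
  have : 0 ≤ (r - 1) ^ 2 * (r + 2) / (2 * r) := by positivity
  linarith

lemma three_halves_lt_inv_add_sq {r : ℝ} (hr : 0 < r) (h1 : r ≠ 1) :
    3 / 2 < 1 / r + r ^ 2 / 2 := by
  have h : 1 / r + r ^ 2 / 2 - 3 / 2 = (r - 1) ^ 2 * (r + 2) / (2 * r) := by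
    field_simp
    ring
  have : r - 1 ≠ 0 := sub_ne_zero.mpr h1
  have : 0 < (r - 1) ^ 2 * (r + 2) / (2 * r) := by positivity
  linarith

/-- The effective potential in terms of the distances to the two primaries. -/
lemma V_eq_distances (μ x y : ℝ) :
    V μ (x, y) = μ * (1 - μ) / 2
      - μ * (1 / √((x - (1 - μ)) ^ 2 + y ^ 2) + √((x - (1 - μ)) ^ 2 + y ^ 2) ^ 2 / 2)
      - (1 - μ) * (1 / √((x + μ) ^ 2 + y ^ 2) + √((x + μ) ^ 2 + y ^ 2) ^ 2 / 2) := by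
  rw [Real.sq_sqrt (by positivity), Real.sq_sqrt (by positivity)]
  simp only [V]
  ring

lemma sqrt_sq_add_sq_pos {a b : ℝ} (h : a ≠ 0 ∨ b ≠ 0) : 0 < √(a ^ 2 + b ^ 2) := by
  rcases h with h | h <;> positivity

lemma V_le {μ x y : ℝ} (hμ : μ ∈ Ioo (0 : ℝ) 1) (he : x - (1 - μ) ≠ 0 ∨ y ≠ 0)
    (hs : x + μ ≠ 0 ∨ y ≠ 0) : V μ (x, y) ≤ (μ * (1 - μ) - 3) / 2 := by
  obtain ⟨h0, h1⟩ := hμ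
  rw [V_eq_distances]
  have A := mul_le_mul_of_nonneg_left
    (three_halves_le_inv_add_sq (sqrt_sq_add_sq_pos he)) h0.le
  have B := mul_le_mul_of_nonneg_left
    (three_halves_le_inv_add_sq (sqrt_sq_add_sq_pos hs)) (sub_pos.mpr h1).le
  linarith

lemma V_lt {μ x y : ℝ} (hμ : μ ∈ Ioo (0 : ℝ) 1) (he : x - (1 - μ) ≠ 0 ∨ y ≠ 0)
    (hs : x + μ ≠ 0 ∨ y ≠ 0)
    (hne : ¬ (√((x - (1 - μ)) ^ 2 + y ^ 2) = 1 ∧ √((x + μ) ^ 2 + y ^ 2) = 1)) :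
    V μ (x, y) < (μ * (1 - μ) - 3) / 2 := by
  obtain ⟨h0, h1⟩ := hμ
  rw [V_eq_distances]
  have A := mul_le_mul_of_nonneg_left
    (three_halves_le_inv_add_sq (sqrt_sq_add_sq_pos he)) h0.le
  have B := mul_le_mul_of_nonneg_left
    (three_halves_le_inv_add_sq (sqrt_sq_add_sq_pos hs)) (sub_pos.mpr h1).le
  rcases not_and_or.mp hne with h | h
  · have A' := mul_lt_mul_of_pos_left
      (three_halves_lt_inv_add_sq (sqrt_sq_add_sq_pos he) h) h0
    linarith
  · have B' := mul_lt_mul_of_pos_left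
      (three_halves_lt_inv_add_sq (sqrt_sq_add_sq_pos hs) h) (sub_pos.mpr h1)
    linarith

lemma V_eq_of_sq_eq (μ : ℝ) {y : ℝ} (hy : y ^ 2 = 3 / 4) :
    V μ (1 / 2 - μ, y) = (μ * (1 - μ) - 3) / 2 := by
  have h1 : (1 / 2 - μ - (1 - μ)) ^ 2 + y ^ 2 = 1 := by rw [hy]; ring
  have h2 : (1 / 2 - μ + μ) ^ 2 + y ^ 2 = 1 := by rw [hy]; ring
  rw [V_eq_distances, h1, h2, Real.sqrt_one]
  ring

lemma Vq1_eq_zero {μ y : ℝ} (hμ : μ ∈ Ioo (0 : ℝ) 1) (hy : y ^ 2 = 3 / 4) :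
    Vq1 μ (1 / 2 - μ, y) = 0 := by
  have hy0 : y ≠ 0 := by rintro rfl; norm_num at hy
  refine IsLocalMax.deriv_eq_zero (Filter.Eventually.of_forall fun a => ?_)
  simp only [V_eq_of_sq_eq μ hy]
  exact V_le hμ (.inr hy0) (.inr hy0)

lemma Vq2_eq_zero {μ y : ℝ} (hμ : μ ∈ Ioo (0 : ℝ) 1) (hy : y ^ 2 = 3 / 4) :
    Vq2 μ (1 / 2 - μ, y) = 0 := by
  refine IsLocalMax.deriv_eq_zero (Filter.Eventually.of_forall fun b => ?_)
  simp only [V_eq_of_sq_eq μ hy]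
  exact V_le hμ (.inl (by ring_nf; norm_num)) (.inl (by ring_nf; norm_num))

/-- `ℓ₄ = (1/2 - μ, √3/2)` and `ℓ₅ = (1/2 - μ, -√3/2)` are critical points of `V` with
value `(μ(1-μ) - 3)/2`, and they are the strict global maxima of `V`. -/
theorem ell4_ell5_global_maxima (μ : ℝ) (hμ : μ ∈ Ioo (0 : ℝ) 1) :
    (Vq1 μ (1 / 2 - μ, Real.sqrt 3 / 2) = 0 ∧ Vq2 μ (1 / 2 - μ, Real.sqrt 3 / 2) = 0)
    ∧ (Vq1 μ (1 / 2 - μ, -(Real.sqrt 3 / 2)) = 0 ∧ Vq2 μ (1 / 2 - μ, -(Real.sqrt 3 / 2)) = 0)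
    ∧ V μ (1 / 2 - μ, Real.sqrt 3 / 2) = (μ * (1 - μ) - 3) / 2
    ∧ V μ (1 / 2 - μ, -(Real.sqrt 3 / 2)) = (μ * (1 - μ) - 3) / 2
    ∧ ∀ q : ℝ × ℝ, q ≠ (1 - μ, 0) → q ≠ (-μ, 0) →
        q ≠ (1 / 2 - μ, Real.sqrt 3 / 2) → q ≠ (1 / 2 - μ, -(Real.sqrt 3 / 2)) →
        V μ q < (μ * (1 - μ) - 3) / 2 := by
  have h4 : (√3 / 2) ^ 2 = 3 / 4 := by
    rw [div_pow, Real.sq_sqrt (by norm_num)]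
    norm_num
  have h5 : (-(√3 / 2)) ^ 2 = 3 / 4 := by rw [neg_sq, h4]
  refine ⟨⟨Vq1_eq_zero hμ h4, Vq2_eq_zero hμ h4⟩, ⟨Vq1_eq_zero hμ h5, Vq2_eq_zero hμ h5⟩,
    V_eq_of_sq_eq μ h4, V_eq_of_sq_eq μ h5, ?_⟩
  rintro ⟨x, y⟩ he hs hl4 hl5
  refine V_lt hμ ?_ ?_ ?_
  · by_contra! h
    exact he (Prod.ext (sub_eq_zero.mp h.1) h.2)
  · by_contra! h
    exact hs (Prod.ext (eq_neg_of_add_eq_zero_left h.1) h.2)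
  · rintro ⟨h1, h2⟩
    rw [Real.sqrt_eq_one] at h1 h2
    have hx : x = 1 / 2 - μ := by linarith
    subst hx
    have hy : y ^ 2 = (√3 / 2) ^ 2 := by linarith
    rcases sq_eq_sq_iff_eq_or_eq_neg.mp hy with rfl | rfl
    · exact hl4 rfl
    · exact hl5 rfl
end

section
/- Let μ ∈ (0,1). Then u has exactly one critical point in each of the three intervals (-∞, -μ), (-μ, 1-μ), and (1-μ, ∞) (denoted ℓ₃, ℓ₁, ℓ₂ respectively), each of these critical points is a strict local maximum of u, and u has no other critical points. -/
open Real Set Filter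

/-- The derivative of `u μ` away from the singularities. -/
noncomputable def uDeriv (μ x : ℝ) : ℝ :=
  μ * (SignType.sign (x - (1 - μ)) / (x - (1 - μ)) ^ 2)
    + (1 - μ) * (SignType.sign (x + μ) / (x + μ) ^ 2) - x

theorem hasDerivAt_inv_abs {x : ℝ} (hx : x ≠ 0) :
    HasDerivAt (fun y : ℝ => |y|⁻¹) (-(SignType.sign x / x ^ 2)) x := by
  have h := (hasDerivAt_abs hx).inv (abs_ne_zero.mpr hx)
  rw [sq_abs, neg_div] at h
  exact h

theorem hasDerivAt_u {μ x : ℝ} (h₁ : x ≠ -μ) (h₂ : x ≠ 1 - μ) :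
    HasDerivAt (u μ) (uDeriv μ x) x := by
  have ha : x - (1 - μ) ≠ 0 := sub_ne_zero.mpr h₂
  have hb : x + μ ≠ 0 := fun h => h₁ (by linarith)
  have hA := (hasDerivAt_inv_abs ha).comp x ((hasDerivAt_id x).sub_const (1 - μ))
  have hB := (hasDerivAt_inv_abs hb).comp x ((hasDerivAt_id x).add_const μ)
  have h := ((hA.const_mul (-μ)).sub (hB.const_mul (1 - μ))).sub
    (((hasDerivAt_id x).pow 2).div_const 2)
  refine HasDerivAt.congr_deriv (f := u μ) h ?_
  simp only [uDeriv, id]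
  norm_num

theorem sign_div_sq_lt {x y : ℝ} (hxy : x < y) (h : 0 < x ∨ y < 0) :
    (SignType.sign y : ℝ) / y ^ 2 < SignType.sign x / x ^ 2 := by
  rcases h with h | h
  · rw [sign_pos h, sign_pos (h.trans hxy)]
    simp only [SignType.coe_one]
    exact one_div_lt_one_div_of_lt (by positivity) (by nlinarith)
  · rw [sign_neg h, sign_neg (hxy.trans h)]
    simp only [SignType.coe_neg, SignType.coe_one, neg_div]
    exact neg_lt_neg (one_div_lt_one_div_of_lt (by nlinarith) (by nlinarith))

theorem uDeriv_strictAntiOn {μ : ℝ} (hμ : μ ∈ Ioo (0 : ℝ) 1) {s : Set ℝ} (hs : s.OrdConnected)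
    (h₁ : -μ ∉ s) (h₂ : 1 - μ ∉ s) : StrictAntiOn (uDeriv μ) s := by
  have sep {c : ℝ} (hc : c ∉ s) {x y : ℝ} (hx : x ∈ s) (hy : y ∈ s) : c < x ∨ y < c := by
    by_contra! h
    exact hc (hs.out hx hy h)
  intro x hx y hy hxy
  have hA := sign_div_sq_lt (x := x - (1 - μ)) (y := y - (1 - μ)) (by linarith)
    ((sep h₂ hx hy).imp (by intro; linarith) (by intro; linarith))
  have hB := sign_div_sq_lt (x := x + μ) (y := y + μ) (by linarith)
    ((sep h₁ hx hy).imp (by intro; linarith) (by intro; linarith))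
  have hA' := mul_lt_mul_of_pos_left hA hμ.1
  have hB' := mul_lt_mul_of_pos_left hB (sub_pos.mpr hμ.2)
  unfold uDeriv
  linarith

theorem continuousAt_uDeriv {μ x : ℝ} (h₁ : x ≠ -μ) (h₂ : x ≠ 1 - μ) :
    ContinuousAt (uDeriv μ) x := by
  have key {y : ℝ} (hy : y ≠ 0) :
      ContinuousAt (fun z : ℝ => (SignType.sign z : ℝ) / z ^ 2) y := by
    refine ContinuousAt.div ?_ (by fun_prop) (pow_ne_zero 2 hy)
    exact (continuous_of_discreteTopology (f := ((↑) : SignType → ℝ))).continuousAt.comp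
      (continuousAt_sign_of_ne_zero hy)
  have hA := (key (sub_ne_zero.mpr h₂)).comp (f := fun z => z - (1 - μ)) (by fun_prop)
  have hB := (key (y := x + μ) (fun h => h₁ (by linarith))).comp (f := fun z => z + μ)
    (by fun_prop)
  exact ((hA.const_mul μ).add (hB.const_mul (1 - μ))).sub continuousAt_id

theorem existsUnique_deriv_u_eq_zero {μ : ℝ} (hμ : μ ∈ Ioo (0 : ℝ) 1) {s : Set ℝ}
    (hs : s.OrdConnected) (h₁ : -μ ∉ s) (h₂ : 1 - μ ∉ s) {a b : ℝ} (ha : a ∈ s) (hb : b ∈ s)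
    (hab : a ≤ b) (hpos : 0 ≤ uDeriv μ a) (hneg : uDeriv μ b ≤ 0) :
    ∃! x, x ∈ s ∧ deriv (u μ) x = 0 := by
  have hne {x : ℝ} (hx : x ∈ s) : x ≠ -μ ∧ x ≠ 1 - μ :=
    ⟨ne_of_mem_of_not_mem hx h₁, ne_of_mem_of_not_mem hx h₂⟩
  have hderiv {x : ℝ} (hx : x ∈ s) : deriv (u μ) x = uDeriv μ x :=
    (hasDerivAt_u (hne hx).1 (hne hx).2).deriv
  have hcont : ContinuousOn (uDeriv μ) (Icc a b) := fun x hx =>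
    (continuousAt_uDeriv (hne (hs.out ha hb hx)).1 (hne (hs.out ha hb hx)).2).continuousWithinAt
  obtain ⟨x, hx, hx0⟩ := intermediate_value_Icc' hab hcont ⟨hneg, hpos⟩
  have hxs := hs.out ha hb hx
  refine ⟨x, ⟨hxs, (hderiv hxs).trans hx0⟩, fun y ⟨hys, hy0⟩ => ?_⟩
  rw [hderiv hys] at hy0
  exact (uDeriv_strictAntiOn hμ hs h₁ h₂).injOn hys hxs (hy0.trans hx0.symm)

theorem u_lt_of_deriv_eq_zero {μ : ℝ} (hμ : μ ∈ Ioo (0 : ℝ) 1) {s : Set ℝ}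
    (hs : s.OrdConnected) (h₁ : -μ ∉ s) (h₂ : 1 - μ ∉ s) {x y : ℝ} (hx : x ∈ s) (hy : y ∈ s)
    (hyx : y ≠ x) (h0 : deriv (u μ) x = 0) : u μ y < u μ x := by
  have hd {z : ℝ} (hz : z ∈ s) : HasDerivAt (u μ) (uDeriv μ z) z :=
    hasDerivAt_u (ne_of_mem_of_not_mem hz h₁) (ne_of_mem_of_not_mem hz h₂)
  have hanti := uDeriv_strictAntiOn hμ hs h₁ h₂
  rw [(hd hx).deriv] at h0
  rcases hyx.lt_or_gt with h | h
  · obtain ⟨c, hc, hslope⟩ := exists_hasDerivAt_eq_slope (u μ) (uDeriv μ) h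
      (fun z hz => (hd (hs.out hy hx hz)).continuousAt.continuousWithinAt)
      (fun z hz => hd (hs.out hy hx (Ioo_subset_Icc_self hz)))
    have hlt := hanti (hs.out hy hx (Ioo_subset_Icc_self hc)) hx hc.2
    rw [h0, hslope, div_pos_iff_of_pos_right (sub_pos.mpr h)] at hlt
    exact sub_pos.mp hlt
  · obtain ⟨c, hc, hslope⟩ := exists_hasDerivAt_eq_slope (u μ) (uDeriv μ) h
      (fun z hz => (hd (hs.out hx hy hz)).continuousAt.continuousWithinAt)
      (fun z hz => hd (hs.out hx hy (Ioo_subset_Icc_self hz)))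
    have hlt := hanti hx (hs.out hx hy (Ioo_subset_Icc_self hc)) hc.1
    rw [h0, hslope, div_lt_iff₀ (sub_pos.mpr h), zero_mul] at hlt
    exact sub_neg.mp hlt

theorem uDeriv_of_gt {μ x : ℝ} (h : 1 - μ < x) :
    uDeriv μ x = μ / (x - (1 - μ)) ^ 2 + (1 - μ) / (x + μ) ^ 2 - x := by
  rw [uDeriv, sign_pos (by linarith), sign_pos (by linarith)]
  simp only [SignType.coe_one]
  ring

theorem uDeriv_of_mem_Ioo {μ x : ℝ} (h : x ∈ Ioo (-μ) (1 - μ)) :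
    uDeriv μ x = -(μ / (x - (1 - μ)) ^ 2) + (1 - μ) / (x + μ) ^ 2 - x := by
  rw [uDeriv, sign_neg (by linarith [h.2]), sign_pos (by linarith [h.1])]
  simp only [SignType.coe_neg, SignType.coe_one]
  ring

theorem uDeriv_of_lt {μ x : ℝ} (h : x < -μ) :
    uDeriv μ x = -(μ / (x - (1 - μ)) ^ 2) - (1 - μ) / (x + μ) ^ 2 - x := by
  rw [uDeriv, sign_neg (by linarith), sign_neg (by linarith)]
  simp only [SignType.coe_neg, SignType.coe_one]
  ring

/-- `u` has exactly one critical point in each of the intervals `(-∞,-μ)`, `(-μ,1-μ)`,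
`(1-μ,∞)`, each of which is a strict local maximum, and no other critical points. -/
theorem u_critical_points (μ : ℝ) (hμ : μ ∈ Ioo (0 : ℝ) 1) :
    (∃! x, x ∈ Iio (-μ) ∧ deriv (u μ) x = 0)
    ∧ (∃! x, x ∈ Ioo (-μ) (1 - μ) ∧ deriv (u μ) x = 0)
    ∧ (∃! x, x ∈ Ioi (1 - μ) ∧ deriv (u μ) x = 0)
    -- each critical point (away from the singularities) is a strict local maximum
    ∧ (∀ x : ℝ, x ≠ -μ → x ≠ 1 - μ → deriv (u μ) x = 0 →
        ∀ᶠ y in nhdsWithin x {x}ᶜ, u μ y < u μ x) := by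
  obtain ⟨h0, h1⟩ := id hμ
  have hν : 0 < 1 - μ := by linarith
  have div_sq_le {m t : ℝ} (hm : 0 ≤ m) (ht : 1 ≤ t ^ 2) : m / t ^ 2 ≤ m := div_le_self hm ht
  have one_lt_div_sq {m : ℝ} (hm : 0 < m) (hm1 : m < 1) : 1 < m / m ^ 2 := by
    rw [one_lt_div (by positivity)]
    nlinarith
  have four_lt {m : ℝ} (hm : 0 < m) (hm1 : m < 1) : 4 < m / (m / 2) ^ 2 := by
    rw [lt_div_iff₀ (by positivity)]
    nlinarith
  refine ⟨?_, ?_, ?_, ?_⟩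
  · refine existsUnique_deriv_u_eq_zero hμ ordConnected_Iio (by simp) (by simp)
      (a := -2) (b := -1) (by simp; linarith) (by simp; linarith) (by norm_num) ?_ ?_
    · rw [uDeriv_of_lt (by linarith)]
      linarith [div_sq_le (t := -2 - (1 - μ)) h0.le (by nlinarith),
        div_sq_le (t := -2 + μ) hν.le (by nlinarith)]
    · rw [uDeriv_of_lt (by linarith), show (-1 + μ) ^ 2 = (1 - μ) ^ 2 by ring]
      have : 0 ≤ μ / (-1 - (1 - μ)) ^ 2 := by positivity
      linarith [one_lt_div_sq hν (by linarith)]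
  · have ha : (1 - 3 * μ) / 2 ∈ Ioo (-μ) (1 - μ) := ⟨by linarith, by linarith⟩
    have hb : 1 - 3 * μ / 2 ∈ Ioo (-μ) (1 - μ) := ⟨by linarith, by linarith⟩
    refine existsUnique_deriv_u_eq_zero hμ ordConnected_Ioo (by simp) (by simp)
      ha hb (by linarith) ?_ ?_
    · rw [uDeriv_of_mem_Ioo ha, show (1 - 3 * μ) / 2 + μ = (1 - μ) / 2 by ring]
      have : μ / ((1 - 3 * μ) / 2 - (1 - μ)) ^ 2 ≤ 1 := by
        rw [div_le_one (by nlinarith)]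
        nlinarith [sq_nonneg (1 - μ)]
      linarith [four_lt hν (by linarith)]
    · rw [uDeriv_of_mem_Ioo hb, show (1 - 3 * μ / 2 - (1 - μ)) ^ 2 = (μ / 2) ^ 2 by ring]
      have : (1 - μ) / (1 - 3 * μ / 2 + μ) ^ 2 ≤ 1 := by
        rw [div_le_one (by nlinarith)]
        nlinarith [sq_nonneg μ]
      linarith [four_lt h0 h1]
  · refine existsUnique_deriv_u_eq_zero hμ ordConnected_Ioi (by simp) (by simp)
      (a := 1) (b := 2) (by simp; linarith) (by simp; linarith) (by norm_num) ?_ ?_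
    · rw [uDeriv_of_gt (by linarith), show (1 - (1 - μ)) ^ 2 = μ ^ 2 by ring]
      have : 0 ≤ (1 - μ) / (1 + μ) ^ 2 := by positivity
      linarith [one_lt_div_sq h0 h1]
    · rw [uDeriv_of_gt (by linarith)]
      linarith [div_sq_le (t := 2 - (1 - μ)) h0.le (by nlinarith),
        div_sq_le (t := 2 + μ) hν.le (by nlinarith)]
  · intro x hx₁ hx₂ hx0
    have hopen : ({-μ, 1 - μ}ᶜ : Set ℝ) ∈ nhds x :=
      (Set.toFinite _).isClosed.isOpen_compl.mem_nhds (by simp [hx₁, hx₂])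
    obtain ⟨ε, hε, hball⟩ := Metric.mem_nhds_iff.mp hopen
    have h₁ : -μ ∉ Metric.ball x ε := fun h => hball h (by simp)
    have h₂ : 1 - μ ∉ Metric.ball x ε := fun h => hball h (by simp)
    filter_upwards [self_mem_nhdsWithin, mem_nhdsWithin_of_mem_nhds (Metric.ball_mem_nhds x hε)]
      with y hyx hy
    exact u_lt_of_deriv_eq_zero hμ (convex_ball x ε).ordConnected h₁ h₂
      (Metric.mem_ball_self hε) hy hyx hx0
end

section
/- Let μ ∈ (0,1), let x ∈ (-μ, 1-μ), set ρ = (1-μ) - x ∈ (0,1) and x' = (1-μ) + ρ. Then u(x) - u(x') = -2(1-μ)ρ³/(1-ρ²), and in particular u(x) < u(x'). -/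
open Real Set

/-- For a point `x` between the primaries with `ρ = (1-μ) - x`, the value of `u` at `x`
is smaller than at the symmetric point `x' = (1-μ) + ρ` on the other side of the earth,
with explicit difference `u(x) - u(x') = -2(1-μ)ρ³/(1-ρ²)`. -/
theorem u_smaller_between_primaries (μ : ℝ) (hμ : μ ∈ Ioo (0 : ℝ) 1)
    (x : ℝ) (hx : x ∈ Ioo (-μ) (1 - μ)) :
    u μ x - u μ ((1 - μ) + ((1 - μ) - x))
        = -(2 * (1 - μ) * ((1 - μ) - x) ^ 3) / (1 - ((1 - μ) - x) ^ 2)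
      ∧ u μ x < u μ ((1 - μ) + ((1 - μ) - x)) := by
  obtain ⟨-, hμ1⟩ := hμ
  obtain ⟨hx0, hx1⟩ := hx
  obtain ⟨ρ, hρ⟩ : ∃ ρ, ρ = (1 - μ) - x := ⟨_, rfl⟩
  obtain rfl : x = (1 - μ) - ρ := by linarith
  have hρ0 : 0 < ρ := by linarith
  have hρ1 : 0 < 1 - ρ := by linarith
  have hsq : 0 < 1 - ρ ^ 2 := by nlinarith
  rw [← hρ]
  have hdiff : u μ (1 - μ - ρ) - u μ (1 - μ + ρ)
      = -(2 * (1 - μ) * ρ ^ 3) / (1 - ρ ^ 2) := by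
    have hmoon : |1 - μ - ρ + μ| = 1 - ρ := by
      rw [abs_of_pos] <;> linarith
    have hmoon' : |1 - μ + ρ + μ| = 1 + ρ := by
      rw [abs_of_pos] <;> linarith
    have hearth : |1 - μ - ρ - (1 - μ)| = ρ := by
      rw [abs_of_neg] <;> linarith
    have hearth' : |1 - μ + ρ - (1 - μ)| = ρ := by
      rw [abs_of_pos] <;> linarith
    have hfactor : 1 - ρ ^ 2 = (1 - ρ) * (1 + ρ) := by ring
    have hne : 1 + ρ ≠ 0 := by positivity
    rw [u, u, hmoon, hmoon', hearth, hearth', hfactor]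
    field_simp
    ring
  refine ⟨hdiff, sub_neg.mp ?_⟩
  rw [hdiff]
  have hμ' : 0 < 1 - μ := by linarith
  exact div_neg_of_neg_of_pos (neg_neg_of_pos (by positivity)) hsq
end

section
/- Let μ ∈ (0,1), and let ℓ₁ ∈ (-μ, 1-μ), ℓ₂ ∈ (1-μ, ∞), ℓ₃ ∈ (-∞, -μ) be the unique critical points of u in these intervals. Then u(ℓ₁) < u(ℓ₂) and u(ℓ₁) < u(ℓ₃); i.e., the first critical value of the restricted three-body problem lies strictly below the second and third critical values. -/
open Real Set

/-- Reflecting the axis exchanges the two primaries. -/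
theorem u_one_sub_neg (μ x : ℝ) : u (1 - μ) (-x) = u μ x := by
  have h₁ : |-x - (1 - (1 - μ))| = |x + μ| := by rw [← abs_neg]; congr 1; ring
  have h₂ : |-x + (1 - μ)| = |x - (1 - μ)| := by rw [← abs_neg]; congr 1; ring
  unfold u
  rw [h₁, h₂]
  ring

theorem deriv_u_one_sub_neg (μ x : ℝ) : deriv (u (1 - μ)) (-x) = -deriv (u μ) x := by
  have h : u μ = fun y => u (1 - μ) (-y) := funext fun y => (u_one_sub_neg μ y).symm
  rw [h, deriv_comp_neg, neg_neg]

/-- The tangent line inequality for the convex function `t ↦ 1 / t` on the positive reals. -/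
theorem one_div_sub_div_sq_le {a b : ℝ} (ha : 0 < a) (hb : 0 < b) :
    1 / a - (b - a) / a ^ 2 ≤ 1 / b := by
  have h : 1 / b - (1 / a - (b - a) / a ^ 2) = (b - a) ^ 2 / (a ^ 2 * b) := by
    field_simp
    ring
  have : 0 ≤ (b - a) ^ 2 / (a ^ 2 * b) := by positivity
  linarith

theorem u_of_gt {μ x : ℝ} (hx : 1 - μ < x) :
    u μ x = -μ / (x - (1 - μ)) - (1 - μ) / (x + μ) - x ^ 2 / 2 := by
  rw [u, abs_of_pos (by linarith), abs_of_pos (by linarith)]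

theorem hasDerivAt_u_of_gt {μ x : ℝ} (hx : 1 - μ < x) :
    HasDerivAt (u μ) (μ / (x - (1 - μ)) ^ 2 + (1 - μ) / (x + μ) ^ 2 - x) x := by
  have h₁ : x - (1 - μ) ≠ 0 := by linarith
  have h₂ : x + μ ≠ 0 := by linarith
  have h := ((((hasDerivAt_const x (-μ)).div ((hasDerivAt_id x).sub_const (1 - μ)) h₁).sub
    ((hasDerivAt_const x (1 - μ)).div ((hasDerivAt_id x).add_const μ) h₂)).sub
    (((hasDerivAt_id x).pow 2).div_const 2))
  refine (h.congr_of_eventuallyEq ?_).congr_deriv ?_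
  · filter_upwards [Ioi_mem_nhds hx] with y hy
    simpa using u_of_gt hy
  · simp
    ring

/-- A critical point to the right of both primaries is a maximum on that side. -/
theorem u_le_of_deriv_eq_zero {μ l y : ℝ} (hμ : μ ∈ Ioo (0 : ℝ) 1) (hl : 1 - μ < l)
    (hcrit : deriv (u μ) l = 0) (hy : 1 - μ < y) : u μ y ≤ u μ l := by
  rw [(hasDerivAt_u_of_gt hl).deriv] at hcrit
  rw [u_of_gt hl, u_of_gt hy]
  have h₁ := mul_le_mul_of_nonneg_left
    (one_div_sub_div_sq_le (a := l - (1 - μ)) (b := y - (1 - μ)) (by linarith) (by linarith))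
    hμ.1.le
  have h₂ := mul_le_mul_of_nonneg_left
    (one_div_sub_div_sq_le (a := l + μ) (b := y + μ) (by linarith) (by linarith))
    (sub_nonneg.2 hμ.2.le)
  have h₃ : (y - l) * (μ / (l - (1 - μ)) ^ 2 + (1 - μ) / (l + μ) ^ 2 - l) = 0 := by
    rw [hcrit, mul_zero]
  ring_nf at h₁ h₂ h₃ ⊢
  nlinarith [sq_nonneg (y - l)]

/-- Reflecting a point between the primaries at the right primary increases the potential. -/
theorem u_lt_u_reflection {μ x : ℝ} (hμ : μ < 1) (hx : x ∈ Ioo (-μ) (1 - μ)) :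
    u μ x < u μ (2 * (1 - μ) - x) := by
  obtain ⟨r, rfl⟩ : ∃ r, x = 1 - μ - r := ⟨1 - μ - x, by ring⟩
  have hr₀ : 0 < r := by linarith [hx.2]
  have hr₁ : 0 < 1 - r := by linarith [hx.1]
  have hμ' : 0 < 1 - μ := sub_pos.2 hμ
  have key : u μ (2 * (1 - μ) - (1 - μ - r)) - u μ (1 - μ - r)
      = (1 - μ) * (2 * r ^ 3 / ((1 - r) * (1 + r))) := by
    have e₁ : 2 * (1 - μ) - (1 - μ - r) - (1 - μ) = r := by ring
    have e₂ : 2 * (1 - μ) - (1 - μ - r) + μ = 1 + r := by ring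
    have e₃ : 1 - μ - r - (1 - μ) = -r := by ring
    have e₄ : 1 - μ - r + μ = 1 - r := by ring
    rw [u, u, e₁, e₂, e₃, e₄, abs_neg, abs_of_pos hr₀, abs_of_pos hr₁,
      abs_of_pos (by linarith : 0 < 1 + r)]
    field_simp
    ring
  have : 0 < (1 - μ) * (2 * r ^ 3 / ((1 - r) * (1 + r))) := by positivity
  linarith

/-- A critical value to the right of both primaries exceeds all values between the primaries. -/
theorem u_lt_of_deriv_eq_zero_s6 {μ x l : ℝ} (hμ : μ ∈ Ioo (0 : ℝ) 1)
    (hx : x ∈ Ioo (-μ) (1 - μ)) (hl : 1 - μ < l) (hcrit : deriv (u μ) l = 0) :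
    u μ x < u μ l :=
  (u_lt_u_reflection hμ.2 hx).trans_le
    (u_le_of_deriv_eq_zero hμ hl hcrit (by linarith [hx.2]))

/-- The first critical value lies strictly below the second and third critical values:
`u(ℓ₁) < u(ℓ₂)` and `u(ℓ₁) < u(ℓ₃)`. -/
theorem first_critical_value_lowest (μ : ℝ) (hμ : μ ∈ Ioo (0 : ℝ) 1)
    (ℓ₁ ℓ₂ ℓ₃ : ℝ)
    (hℓ₁ : ℓ₁ ∈ Ioo (-μ) (1 - μ)) (hcrit₁ : deriv (u μ) ℓ₁ = 0)
    (huniq₁ : ∀ x ∈ Ioo (-μ) (1 - μ), deriv (u μ) x = 0 → x = ℓ₁)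
    (hℓ₂ : ℓ₂ ∈ Ioi (1 - μ)) (hcrit₂ : deriv (u μ) ℓ₂ = 0)
    (huniq₂ : ∀ x ∈ Ioi (1 - μ), deriv (u μ) x = 0 → x = ℓ₂)
    (hℓ₃ : ℓ₃ ∈ Iio (-μ)) (hcrit₃ : deriv (u μ) ℓ₃ = 0)
    (huniq₃ : ∀ x ∈ Iio (-μ), deriv (u μ) x = 0 → x = ℓ₃) :
    u μ ℓ₁ < u μ ℓ₂ ∧ u μ ℓ₁ < u μ ℓ₃ := by
  refine ⟨u_lt_of_deriv_eq_zero_s6 hμ hℓ₁ hℓ₂ hcrit₂, ?_⟩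
  rw [← u_one_sub_neg μ ℓ₁, ← u_one_sub_neg μ ℓ₃]
  have hℓ₃' : ℓ₃ < -μ := hℓ₃
  refine u_lt_of_deriv_eq_zero_s6 ⟨by linarith [hμ.2], by linarith [hμ.1]⟩
    ⟨by linarith [hℓ₁.2], by linarith [hℓ₁.1]⟩ (by linarith) ?_
  rw [deriv_u_one_sub_neg, hcrit₃, neg_zero]
end

section
/- For μ = 1/2 (so e = (1/2, 0) and s = (-1/2, 0)), every q ∈ ℝ² with ‖q‖ = 1 satisfies V(q) > -2, where -2 = V(0,0) is the value of the effective potential at the origin (the first critical point ℓ₁). -/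
open Real Set

/-- The effective potential of the PCR3BP for mass ratio `μ = 1/2`, with primaries at
`e = (1/2, 0)` and `s = (-1/2, 0)`. -/
noncomputable def Vhalf (q : ℝ × ℝ) : ℝ :=
  -1 / (2 * Real.sqrt ((q.1 - 1 / 2) ^ 2 + q.2 ^ 2))
    - 1 / (2 * Real.sqrt ((q.1 + 1 / 2) ^ 2 + q.2 ^ 2))
    - (q.1 ^ 2 + q.2 ^ 2) / 2

/-- For `μ = 1/2`, the effective potential at the origin (the first critical point `ℓ₁`)
is `-2`, and on the unit circle `V > -2`. -/
theorem V_on_unit_circle_gt :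
    Vhalf (0, 0) = -2
    ∧ ∀ q : ℝ × ℝ, Real.sqrt (q.1 ^ 2 + q.2 ^ 2) = 1 → Vhalf q > -2 := by
  refine ⟨?_, ?_⟩
  · norm_num [Vhalf]
  · rintro ⟨x, y⟩ hq
    have hxy : x ^ 2 + y ^ 2 = 1 := by simpa using hq
    have hx : x ^ 2 ≤ 1 := by nlinarith [sq_nonneg y]
    obtain ⟨hx₁, hx₂⟩ := abs_le.mp ((sq_le_one_iff_abs_le_one x).mp hx)
    simp only [Vhalf, hxy]
    rw [show (x - 1 / 2) ^ 2 + y ^ 2 = 5 / 4 - x by linarith,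
      show (x + 1 / 2) ^ 2 + y ^ 2 = 5 / 4 + x by linarith]
    have ha : 0 < √(5 / 4 - x) := Real.sqrt_pos.mpr (by linarith)
    have hb : 0 < √(5 / 4 + x) := Real.sqrt_pos.mpr (by linarith)
    have ha2 : √(5 / 4 - x) ^ 2 = 5 / 4 - x := Real.sq_sqrt (by linarith)
    have hb2 : √(5 / 4 + x) ^ 2 = 5 / 4 + x := Real.sq_sqrt (by linarith)
    generalize √(5 / 4 - x) = a at *
    generalize √(5 / 4 + x) = b at *
    have hab : 0 < a * b := mul_pos ha hb
    have hp2 : (a * b) ^ 2 = 25 / 16 - x ^ 2 := by rw [mul_pow, ha2, hb2]; ring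
    have hp : 3 / 4 ≤ a * b := by nlinarith
    have hlt : a + b < 3 * (a * b) := by nlinarith
    have hsum : -1 / (2 * a) - 1 / (2 * b) = -((a + b) / (2 * (a * b))) := by
      field_simp
      ring
    have hfrac : (a + b) / (2 * (a * b)) < 3 / 2 := by
      rw [div_lt_iff₀ (by positivity)]
      linarith
    rw [hsum]
    linarith
end

section
/- For μ = 1/2 (so e = (1/2, 0) and s = (-1/2, 0)), every q ∈ ℝ² ∖ {e, s} with ‖q‖ ≤ 1 and |q₂| ≤ 2/3 satisfies 1/(2‖q-e‖³) + 1/(2‖q-s‖³) > 1; i.e., the factor W(q) = 1/(2‖q-e‖³) + 1/(2‖q-s‖³) - 1 of ∂V/∂q₂ is strictly positive on this region. -/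
open Real Set

/-- The sum of half the inverse cubes of `a ∈ (0, 5/6]` and `b ∈ (0, 3/2]` exceeds `1`. -/
lemma one_lt_half_inv_cubes {a b : ℝ} (ha : 0 < a) (hb : 0 < b) (ha' : a ≤ 5 / 6)
    (hb' : b ≤ 3 / 2) : 1 < 1 / (2 * a ^ 3) + 1 / (2 * b ^ 3) := by
  have h₁ : 1 / (2 * (5 / 6 : ℝ) ^ 3) ≤ 1 / (2 * a ^ 3) := by gcongr
  have h₂ : 1 / (2 * (3 / 2 : ℝ) ^ 3) ≤ 1 / (2 * b ^ 3) := by gcongr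
  norm_num at h₁ h₂ ⊢
  linarith

/-- In the closed unit disc with `x ≥ 0` and `|y| ≤ 2/3`, the distance to `(1/2, 0)` is at most
`5/6` and the distance to `(-1/2, 0)` is at most `3/2`. -/
lemma dist_bounds_of_nonneg {x y : ℝ} (hx : 0 ≤ x) (hball : x ^ 2 + y ^ 2 ≤ 1)
    (hlid : |y| ≤ 2 / 3) :
    √((x - 1 / 2) ^ 2 + y ^ 2) ≤ 5 / 6 ∧ √((x + 1 / 2) ^ 2 + y ^ 2) ≤ 3 / 2 := by
  have hx1 : x ≤ 1 := by nlinarith [sq_nonneg y]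
  have hy : y ^ 2 ≤ (2 / 3) ^ 2 := sq_le_sq' (abs_le.mp hlid).1 (abs_le.mp hlid).2
  constructor <;> refine Real.sqrt_le_iff.mpr ⟨by norm_num, ?_⟩ <;> nlinarith

/-- The distance from `q` to a point `(c, 0)` different from `q` is positive. -/
lemma sqrt_sub_sq_add_sq_pos {q : ℝ × ℝ} {c : ℝ} (h : q ≠ (c, 0)) :
    0 < √((q.1 - c) ^ 2 + q.2 ^ 2) := by
  refine Real.sqrt_pos.mpr (lt_of_le_of_ne (by positivity) fun h0 => h ?_)
  ext
  · exact sub_eq_zero.mp (pow_eq_zero_iff two_ne_zero |>.mp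
      (by nlinarith [sq_nonneg (q.1 - c), sq_nonneg q.2]))
  · exact pow_eq_zero_iff two_ne_zero |>.mp
      (by nlinarith [sq_nonneg (q.1 - c), sq_nonneg q.2])

/-- For `μ = 1/2` with `e = (1/2,0)` and `s = (-1/2,0)`, the factor
`W(q) = 1/(2‖q-e‖³) + 1/(2‖q-s‖³) - 1` of `∂V/∂q₂` is strictly positive on the region
`{‖q‖ ≤ 1, |q₂| ≤ 2/3}`. -/
theorem W_pos_on_region (q : ℝ × ℝ)
    (he : q ≠ (1 / 2, 0)) (hs : q ≠ (-(1 / 2), 0))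
    (hball : Real.sqrt (q.1 ^ 2 + q.2 ^ 2) ≤ 1) (hlid : |q.2| ≤ 2 / 3) :
    1 / (2 * Real.sqrt ((q.1 - 1 / 2) ^ 2 + q.2 ^ 2) ^ 3)
      + 1 / (2 * Real.sqrt ((q.1 + 1 / 2) ^ 2 + q.2 ^ 2) ^ 3) > 1 := by
  have hr := sqrt_sub_sq_add_sq_pos he
  have hl := sqrt_sub_sq_add_sq_pos hs
  rw [sub_neg_eq_add] at hl
  have hball' : q.1 ^ 2 + q.2 ^ 2 ≤ 1 := by simpa using hball
  rcases le_total 0 q.1 with hx | hx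
  · obtain ⟨h₁, h₂⟩ := dist_bounds_of_nonneg hx hball' hlid
    exact one_lt_half_inv_cubes hr hl h₁ h₂
  · obtain ⟨h₁, h₂⟩ := dist_bounds_of_nonneg (neg_nonneg.mpr hx) (by simpa using hball') hlid
    rw [show (-q.1 - 1 / 2) ^ 2 = (q.1 + 1 / 2) ^ 2 by ring] at h₁
    rw [show (-q.1 + 1 / 2) ^ 2 = (q.1 - 1 / 2) ^ 2 by ring] at h₂
    rw [add_comm]
    exact one_lt_half_inv_cubes hl hr h₁ h₂
end

section
/- For μ = 1/2 there exists ε > 0 such that for every point q in the connected component of {q ∈ ℝ² ∖ {e,s} : V(q) ≤ -2 + ε} containing the origin, one has ∂V/∂q₂(q) = 0 if and only if q₂ = 0. -/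
open Real Set

/-- Partial derivative `∂V/∂q₂` for `μ = 1/2`. -/
noncomputable def Vhalfq2 (q : ℝ × ℝ) : ℝ := deriv (fun b => Vhalf (q.1, b)) q.2

/-- The function whose product with `q.2` is `∂V/∂q₂`. -/
noncomputable def vertFactor (q : ℝ × ℝ) : ℝ :=
  1 / (2 * √((q.1 - 1 / 2) ^ 2 + q.2 ^ 2) ^ 3)
    + 1 / (2 * √((q.1 + 1 / 2) ^ 2 + q.2 ^ 2) ^ 3) - 1

lemma sq_add_sq_pos_of_ne {q : ℝ × ℝ} {c : ℝ} (h : q ≠ (c, 0)) :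
    0 < (q.1 - c) ^ 2 + q.2 ^ 2 := by
  rcases eq_or_ne q.2 0 with h2 | h2
  · have h1 : q.1 - c ≠ 0 := fun h1 => h (Prod.ext (sub_eq_zero.mp h1) h2)
    positivity
  · positivity

lemma sq_add_sq_pos_of_ne_neg {q : ℝ × ℝ} {c : ℝ} (h : q ≠ (-c, 0)) :
    0 < (q.1 + c) ^ 2 + q.2 ^ 2 := by
  simpa using sq_add_sq_pos_of_ne h

lemma hasDerivAt_inv_two_sqrt {c b : ℝ} (h : 0 < c + b ^ 2) :
    HasDerivAt (fun b => 1 / (2 * √(c + b ^ 2))) (-(b / (2 * √(c + b ^ 2) ^ 3))) b := by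
  have hs : 0 < √(c + b ^ 2) := Real.sqrt_pos.mpr h
  have h1 : HasDerivAt (fun b : ℝ => c + b ^ 2) (2 * b) b := by
    simpa using (hasDerivAt_pow 2 b).const_add c
  have h2 := ((h1.sqrt h.ne').const_mul 2).fun_inv (by positivity)
  simp only [one_div]
  refine h2.congr_deriv ?_
  field_simp

lemma Vhalfq2_eq {q : ℝ × ℝ} (he : q ≠ (1 / 2, 0)) (hs : q ≠ (-(1 / 2), 0)) :
    Vhalfq2 q = q.2 * vertFactor q := by
  have h1 := hasDerivAt_inv_two_sqrt (sq_add_sq_pos_of_ne he)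
  have h2 := hasDerivAt_inv_two_sqrt (sq_add_sq_pos_of_ne_neg hs)
  have h3 : HasDerivAt (fun b : ℝ => (q.1 ^ 2 + b ^ 2) / 2) q.2 q.2 := by
    simpa using ((hasDerivAt_pow 2 q.2).const_add (q.1 ^ 2)).div_const 2
  have h := (h1.fun_neg.fun_sub h2).fun_sub h3
  have hV : (fun b => Vhalf (q.1, b)) = fun b =>
      -(1 / (2 * √((q.1 - 1 / 2) ^ 2 + b ^ 2))) - 1 / (2 * √((q.1 + 1 / 2) ^ 2 + b ^ 2))
        - (q.1 ^ 2 + b ^ 2) / 2 := by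
    funext b
    simp only [Vhalf, neg_div]
  rw [Vhalfq2, hV, h.deriv, vertFactor]
  ring

/-- In bipolar coordinates, the potential stays above `-2 + 1/20` on the curve where
`r⁻³ + s⁻³ = 2`. -/
lemma bipolar_potential_lt {r s : ℝ} (hr : 0 < r) (hrs : r ≤ s) (hsr : s ≤ r + 1)
    (h : 1 / (2 * r ^ 3) + 1 / (2 * s ^ 3) = 1) :
    1 / (2 * r) + 1 / (2 * s) + (r ^ 2 + s ^ 2) / 4 - 1 / 8 < 2 - 1 / 20 := by
  have hs : 0 < s := hr.trans_le hrs
  have hr1 : r ≤ 1 := by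
    by_contra! hr1
    have h1 : 1 < r ^ 3 := one_lt_pow₀ hr1 (by norm_num)
    have h2 : 1 < s ^ 3 := one_lt_pow₀ (hr1.trans_le hrs) (by norm_num)
    have h3 : 1 / (2 * r ^ 3) < 1 / 2 := by gcongr; linarith
    have h4 : 1 / (2 * s ^ 3) < 1 / 2 := by gcongr; linarith
    linarith
  have hs1 : 1 ≤ s := by
    by_contra! hs1
    have h1 : r ^ 3 < 1 := pow_lt_one₀ hr.le (hrs.trans_lt hs1) (by norm_num)
    have h2 : s ^ 3 < 1 := pow_lt_one₀ hs.le hs1 (by norm_num)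
    have h3 : 1 / 2 < 1 / (2 * r ^ 3) := by gcongr; linarith
    have h4 : 1 / 2 < 1 / (2 * s ^ 3) := by gcongr; linarith
    linarith
  have hr2 : 3 / 4 ≤ r := by
    by_contra! hr2
    have h1 : r ^ 3 < (3 / 4) ^ 3 := by gcongr
    have h2 : 1 < 1 / (2 * r ^ 3) := by
      rw [lt_div_iff₀ (by positivity)]
      norm_num at h1
      linarith
    have h3 : 0 < 1 / (2 * s ^ 3) := by positivity
    linarith
  have hfr : 1 / (2 * r) + r ^ 2 / 4 ≤ 81 / 100 := by
    have h1 : 1 / (2 * r) ≤ 81 / 100 - r ^ 2 / 4 := by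
      rw [div_le_iff₀ (by positivity)]
      nlinarith [mul_nonneg (sub_nonneg.mpr hr1) (sub_nonneg.mpr hr2),
        mul_nonneg (mul_nonneg (sub_nonneg.mpr hr1) (sub_nonneg.mpr hr2)) hr.le]
    linarith
  have hfs : 1 / (2 * s) + s ^ 2 / 4 ≤ 5 / 4 := by
    have h1 : 1 / (2 * s) ≤ 5 / 4 - s ^ 2 / 4 := by
      rw [div_le_iff₀ (by positivity)]
      have hs2 : s ≤ 2 := by linarith
      nlinarith [mul_nonneg (sub_nonneg.mpr hs1) (sub_nonneg.mpr hs2),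
        mul_nonneg (mul_nonneg (sub_nonneg.mpr hs1) (sub_nonneg.mpr hs2)) hs.le]
    linarith
  linarith

lemma sqrt_sub_add_sq_le (x y : ℝ) :
    √((x - 1 / 2) ^ 2 + y ^ 2) ≤ √((x + 1 / 2) ^ 2 + y ^ 2) + 1 := by
  have hx : x + 1 / 2 ≥ -√((x + 1 / 2) ^ 2 + y ^ 2) := by
    have := Real.abs_le_sqrt (x := x + 1 / 2) (y := (x + 1 / 2) ^ 2 + y ^ 2)
      (by nlinarith [sq_nonneg y])
    exact (abs_le.mp this).1
  apply Real.sqrt_le_iff.mpr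
  refine ⟨by positivity, ?_⟩
  have := Real.sq_sqrt (show 0 ≤ (x + 1 / 2) ^ 2 + y ^ 2 by positivity)
  nlinarith

lemma sqrt_add_add_sq_le (x y : ℝ) :
    √((x + 1 / 2) ^ 2 + y ^ 2) ≤ √((x - 1 / 2) ^ 2 + y ^ 2) + 1 := by
  have h := sqrt_sub_add_sq_le (-x) y
  rwa [show (-x - 1 / 2) ^ 2 = (x + 1 / 2) ^ 2 by ring,
    show (-x + 1 / 2) ^ 2 = (x - 1 / 2) ^ 2 by ring] at h

lemma lt_Vhalf_of_vertFactor_eq_zero {q : ℝ × ℝ} (he : q ≠ (1 / 2, 0))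
    (hs : q ≠ (-(1 / 2), 0)) (h : vertFactor q = 0) : -2 + 1 / 20 < Vhalf q := by
  have pe := sq_add_sq_pos_of_ne he
  have ps := sq_add_sq_pos_of_ne_neg hs
  have h1 := sqrt_sub_add_sq_le q.1 q.2
  have h2 := sqrt_add_add_sq_le q.1 q.2
  have se := Real.sq_sqrt pe.le
  have ss := Real.sq_sqrt ps.le
  have re := Real.sqrt_pos.mpr pe
  have rs := Real.sqrt_pos.mpr ps
  rw [vertFactor] at h
  rw [Vhalf, neg_div]
  generalize √((q.1 - 1 / 2) ^ 2 + q.2 ^ 2) = r at *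
  generalize √((q.1 + 1 / 2) ^ 2 + q.2 ^ 2) = s at *
  rcases le_total r s with hrs | hrs
  · have := bipolar_potential_lt re hrs h2 (by linarith)
    linarith
  · have := bipolar_potential_lt rs hrs h1 (by linarith)
    linarith

/-- For `μ = 1/2` there exists `ε > 0` such that inside the bounded Hill's region
`𝔎_{-2+ε}^b` (the connected component of the sublevel set `{V ≤ -2+ε}` containing the
origin), the partial derivative `∂V/∂q₂` vanishes exactly on the `q₁`-axis. -/
theorem base_case_below_second_critical_value :
    ∃ ε > (0 : ℝ), ∀ q ∈ connectedComponentIn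
        {q : ℝ × ℝ | q ≠ (1 / 2, 0) ∧ q ≠ (-(1 / 2), 0) ∧ Vhalf q ≤ -2 + ε} (0, 0),
      (Vhalfq2 q = 0 ↔ q.2 = 0) := by
  refine ⟨1 / 20, by norm_num, fun q hq => ?_⟩
  obtain ⟨he, hs, hV⟩ := connectedComponentIn_subset _ _ hq
  have hfactor : vertFactor q ≠ 0 := fun hzero =>
    (hV.trans_lt (lt_Vhalf_of_vertFactor_eq_zero he hs hzero)).false
  rw [Vhalfq2_eq he hs, mul_eq_zero, or_iff_left hfactor]
end

section
/- Let μ ∈ [0,1]. (a) Every critical point q of W (i.e., every q ∈ ℝ² ∖ {e,s} with dW(q) = 0) satisfies q₂ = 0 and |q₁| < 1. (b) For every point (q₁, 0) with |q₁| < 1 and q₁ ∉ {-μ, 1-μ}, one has W(q₁, 0) = μ/|q₁-(1-μ)|³ + (1-μ)/|q₁+μ|³ - 1 > 0. In particular, W has no critical point at which W vanishes. -/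
open Real Set

/-- The factor `W(q) = μ/‖q-e‖³ + (1-μ)/‖q-s‖³ - 1` of the partial derivative
`∂V/∂q₂ = q₂·W` of the effective potential of the PCR3BP. -/
noncomputable def W (μ : ℝ) (q : ℝ × ℝ) : ℝ :=
  μ / Real.sqrt ((q.1 - (1 - μ)) ^ 2 + q.2 ^ 2) ^ 3
    + (1 - μ) / Real.sqrt ((q.1 + μ) ^ 2 + q.2 ^ 2) ^ 3 - 1

/-- Partial derivative `∂W/∂q₁`. -/
noncomputable def Wq1 (μ : ℝ) (q : ℝ × ℝ) : ℝ := deriv (fun a => W μ (a, q.2)) q.1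

/-- Partial derivative `∂W/∂q₂`. -/
noncomputable def Wq2 (μ : ℝ) (q : ℝ × ℝ) : ℝ := deriv (fun b => W μ (q.1, b)) q.2

theorem HasDerivAt.const_div_sqrt_pow_three {f : ℝ → ℝ} {f' x : ℝ} (c : ℝ)
    (hf : HasDerivAt f f' x) (hx : 0 < f x) :
    HasDerivAt (fun t => c / √(f t) ^ 3) (-(3 / 2) * (c * f' / √(f x) ^ 5)) x := by
  have hs : 0 < √(f x) := Real.sqrt_pos.mpr hx
  simp only [div_eq_mul_inv c]
  refine (((hf.sqrt hx.ne').fun_pow 3).fun_inv (pow_pos hs 3).ne').const_mul c |>.congr_deriv ?_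
  field_simp
  norm_num
  ring

/-- The squared distance of `(a, b)` to a point `(d, 0)` of the first axis is positive. -/
theorem sub_sq_add_sq_pos {a b d : ℝ} (h : (a, b) ≠ (d, 0)) : 0 < (a - d) ^ 2 + b ^ 2 := by
  rcases eq_or_ne b 0 with rfl | hb
  · have : a - d ≠ 0 := fun h' => h (by rw [sub_eq_zero.mp h'])
    positivity
  · positivity

theorem add_sq_add_sq_pos {a b d : ℝ} (h : (a, b) ≠ (-d, 0)) : 0 < (a + d) ^ 2 + b ^ 2 := by
  simpa using sub_sq_add_sq_pos h

theorem Wq1_eq {μ a b : ℝ} (he : (a, b) ≠ (1 - μ, 0)) (hs : (a, b) ≠ (-μ, 0)) :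
    Wq1 μ (a, b) = -3 * (μ * (a - (1 - μ)) / √((a - (1 - μ)) ^ 2 + b ^ 2) ^ 5
      + (1 - μ) * (a + μ) / √((a + μ) ^ 2 + b ^ 2) ^ 5) := by
  have h₁ := ((((hasDerivAt_id' a).sub_const (1 - μ)).fun_pow 2).add_const (b ^ 2)
    ).const_div_sqrt_pow_three μ (sub_sq_add_sq_pos he)
  have h₂ := ((((hasDerivAt_id' a).add_const μ).fun_pow 2).add_const (b ^ 2)
    ).const_div_sqrt_pow_three (1 - μ) (add_sq_add_sq_pos hs)
  refine (((h₁.fun_add h₂).sub_const 1).deriv).trans ?_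
  push_cast
  ring

theorem Wq2_eq {μ a b : ℝ} (he : (a, b) ≠ (1 - μ, 0)) (hs : (a, b) ≠ (-μ, 0)) :
    Wq2 μ (a, b) = -3 * b * (μ / √((a - (1 - μ)) ^ 2 + b ^ 2) ^ 5
      + (1 - μ) / √((a + μ) ^ 2 + b ^ 2) ^ 5) := by
  have h₁ := (((hasDerivAt_id' b).fun_pow 2).const_add ((a - (1 - μ)) ^ 2)
    ).const_div_sqrt_pow_three μ (sub_sq_add_sq_pos he)
  have h₂ := (((hasDerivAt_id' b).fun_pow 2).const_add ((a + μ) ^ 2)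
    ).const_div_sqrt_pow_three (1 - μ) (add_sq_add_sq_pos hs)
  refine (((h₁.fun_add h₂).sub_const 1).deriv).trans ?_
  push_cast
  ring

/-- A convex combination with weights `μ` and `1 - μ` of two positive numbers is positive. -/
theorem convex_comb_pos {μ x y : ℝ} (hμ : μ ∈ Icc (0 : ℝ) 1) (hx : 0 < x) (hy : 0 < y) :
    0 < μ * x + (1 - μ) * y :=
  convex_Ioi (𝕜 := ℝ) (0 : ℝ) hx hy hμ.1 (sub_nonneg.mpr hμ.2) (by ring)

theorem snd_eq_zero_of_Wq2_eq_zero {μ a b : ℝ} (hμ : μ ∈ Icc (0 : ℝ) 1)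
    (he : (a, b) ≠ (1 - μ, 0)) (hs : (a, b) ≠ (-μ, 0)) (h : Wq2 μ (a, b) = 0) : b = 0 := by
  rw [Wq2_eq he hs, div_eq_mul_inv, div_eq_mul_inv] at h
  have h₁ := Real.sqrt_pos.mpr (sub_sq_add_sq_pos he)
  have h₂ := Real.sqrt_pos.mpr (add_sq_add_sq_pos hs)
  have := convex_comb_pos hμ (inv_pos.mpr (pow_pos h₁ 5)) (inv_pos.mpr (pow_pos h₂ 5))
  simpa [this.ne'] using h

theorem abs_fst_lt_one_of_Wq1_eq_zero {μ a : ℝ} (hμ : μ ∈ Icc (0 : ℝ) 1)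
    (he : (a, (0 : ℝ)) ≠ (1 - μ, 0)) (hs : (a, (0 : ℝ)) ≠ (-μ, 0)) (h : Wq1 μ (a, 0) = 0) :
    |a| < 1 := by
  rw [Wq1_eq he hs, mul_div_assoc, mul_div_assoc] at h
  have h₁ := pow_pos (Real.sqrt_pos.mpr (sub_sq_add_sq_pos he)) 5
  have h₂ := pow_pos (Real.sqrt_pos.mpr (add_sq_add_sq_pos hs)) 5
  have he' : a ≠ 1 - μ := fun h' => he (by rw [h'])
  have hs' : a ≠ -μ := fun h' => hs (by rw [h'])
  obtain ⟨h0, h1⟩ := hμ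
  rw [abs_lt]
  constructor <;> by_contra! ha
  · have ha₁ : 0 < -(a - (1 - μ)) := by
      have := lt_of_le_of_ne (by linarith : a ≤ 1 - μ) he'
      linarith
    have ha₂ : 0 < -(a + μ) := by
      have := lt_of_le_of_ne (by linarith : a ≤ -μ) hs'
      linarith
    have := convex_comb_pos ⟨h0, h1⟩ (div_pos ha₁ h₁) (div_pos ha₂ h₂)
    simp only [neg_div] at this
    linarith
  · have ha₁ : 0 < a - (1 - μ) := by
      have := lt_of_le_of_ne (by linarith : 1 - μ ≤ a) he'.symm
      linarith
    have ha₂ : 0 < a + μ := by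
      have := lt_of_le_of_ne (by linarith : -μ ≤ a) hs'.symm
      linarith
    have := convex_comb_pos ⟨h0, h1⟩ (div_pos ha₁ h₁) (div_pos ha₂ h₂)
    linarith

/-- The graph of `r ↦ r⁻³` lies above its tangent line at `r = 1`. -/
theorem four_sub_three_mul_le_inv_pow_three {r : ℝ} (hr : 0 < r) : 4 - 3 * r ≤ (r ^ 3)⁻¹ := by
  rw [← one_div, le_div_iff₀ (by positivity)]
  nlinarith [mul_nonneg (sq_nonneg (r - 1)) (by positivity : 0 ≤ 3 * r ^ 2 + 2 * r + 1)]

theorem one_lt_div_abs_pow_three_add {μ x : ℝ} (hμ : μ ∈ Icc (0 : ℝ) 1) (hx : |x| < 1)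
    (hs : x ≠ -μ) (he : x ≠ 1 - μ) :
    1 < μ / |x - (1 - μ)| ^ 3 + (1 - μ) / |x + μ| ^ 3 := by
  have hr₁ : 0 < |x - (1 - μ)| := abs_pos.mpr (sub_ne_zero.mpr he)
  have hr₂ : 0 < |x + μ| := abs_pos.mpr (by rwa [← sub_neg_eq_add, sub_ne_zero])
  have h0 := hμ.1
  have h1 : 0 ≤ 1 - μ := sub_nonneg.mpr hμ.2
  have hmean : μ * |x - (1 - μ)| + (1 - μ) * |x + μ| < 1 := by
    rw [abs_lt] at hx
    rcases lt_or_gt_of_ne hs with hs | hs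
    · rw [abs_of_neg (by linarith : x - (1 - μ) < 0), abs_of_neg (by linarith : x + μ < 0)]
      linarith
    rcases lt_or_gt_of_ne he with he | he
    · rw [abs_of_neg (by linarith : x - (1 - μ) < 0), abs_of_pos (by linarith : 0 < x + μ)]
      have := convex_comb_pos hμ (by linarith : 0 < x + μ) (by linarith : 0 < 1 - μ - x)
      linarith
    · rw [abs_of_pos (by linarith : 0 < x - (1 - μ)), abs_of_pos (by linarith : 0 < x + μ)]
      linarith
  have h₁ := mul_le_mul_of_nonneg_left (four_sub_three_mul_le_inv_pow_three hr₁) h0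
  have h₂ := mul_le_mul_of_nonneg_left (four_sub_three_mul_le_inv_pow_three hr₂) h1
  rw [div_eq_mul_inv, div_eq_mul_inv]
  linarith

theorem W_fst_axis (μ x : ℝ) :
    W μ (x, 0) = μ / |x - (1 - μ)| ^ 3 + (1 - μ) / |x + μ| ^ 3 - 1 := by
  simp [W, Real.sqrt_sq_eq_abs]

theorem W_fst_axis_pos {μ x : ℝ} (hμ : μ ∈ Icc (0 : ℝ) 1) (hx : |x| < 1)
    (hs : x ≠ -μ) (he : x ≠ 1 - μ) : 0 < W μ (x, 0) := by
  rw [W_fst_axis]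
  exact sub_pos.mpr (one_lt_div_abs_pow_three_add hμ hx hs he)

/-- (a) Every critical point of `W` lies on the `q₁`-axis with `|q₁| < 1`;
(b) at such points `W` is strictly positive; in particular `W` has no critical point at
which `W` vanishes. -/
theorem W_critical_points (μ : ℝ) (hμ : μ ∈ Icc (0 : ℝ) 1) :
    (∀ q : ℝ × ℝ, q ≠ (1 - μ, 0) → q ≠ (-μ, 0) →
        Wq1 μ q = 0 → Wq2 μ q = 0 → q.2 = 0 ∧ |q.1| < 1)
    ∧ (∀ q₁ : ℝ, |q₁| < 1 → q₁ ≠ -μ → q₁ ≠ 1 - μ →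
        W μ (q₁, 0) = μ / |q₁ - (1 - μ)| ^ 3 + (1 - μ) / |q₁ + μ| ^ 3 - 1
          ∧ W μ (q₁, 0) > 0)
    ∧ (∀ q : ℝ × ℝ, q ≠ (1 - μ, 0) → q ≠ (-μ, 0) →
        Wq1 μ q = 0 → Wq2 μ q = 0 → W μ q ≠ 0) := by
  refine ⟨?_, fun x hx hs he => ⟨W_fst_axis μ x, W_fst_axis_pos hμ hx hs he⟩, ?_⟩
  · rintro ⟨a, b⟩ he hs h₁ h₂
    obtain rfl : b = 0 := snd_eq_zero_of_Wq2_eq_zero hμ he hs h₂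
    exact ⟨rfl, abs_fst_lt_one_of_Wq1_eq_zero hμ he hs h₁⟩
  · rintro ⟨a, b⟩ he hs h₁ h₂
    obtain rfl : b = 0 := snd_eq_zero_of_Wq2_eq_zero hμ he hs h₂
    exact (W_fst_axis_pos hμ (abs_fst_lt_one_of_Wq1_eq_zero hμ he hs h₁)
      (fun h => hs (by rw [h])) (fun h => he (by rw [h]))).ne'
end

section
/- Let μ ∈ (0,1) and let q ∈ ℝ² ∖ {e,s} with q₂ ≠ 0. If ∂V/∂q₂(q) = 0, then ∂²V/∂q₂²(q) ≠ 0. (The oval of zero velocity has no vertical point of inflexion away from the q₁-axis.) -/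
open Real Set

/-- Second partial derivative `∂²V/∂q₂²`. -/
noncomputable def Vq2q2 (μ : ℝ) (q : ℝ × ℝ) : ℝ :=
  deriv (deriv fun b => V μ (q.1, b)) q.2

/-- Derivative of an inverse power of the distance `√(c² + b²)`, away from `b = 0`. -/
lemma hasDerivAt_inv_sqrt_sq_add_sq_pow (c : ℝ) {b : ℝ} (hb : b ≠ 0) (n : ℕ) :
    HasDerivAt (fun t : ℝ => (√(c ^ 2 + t ^ 2) ^ n)⁻¹)
      (-(n * b * (√(c ^ 2 + b ^ 2) ^ (n + 2))⁻¹)) b := by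
  have hpos : 0 < c ^ 2 + b ^ 2 := by positivity
  have hr : √(c ^ 2 + b ^ 2) ≠ 0 := (Real.sqrt_pos.2 hpos).ne'
  have hsqrt : HasDerivAt (fun t : ℝ => √(c ^ 2 + t ^ 2)) (b / √(c ^ 2 + b ^ 2)) b := by
    refine ((((hasDerivAt_id b).pow 2).const_add (c ^ 2)).sqrt hpos.ne').congr_deriv ?_
    simp only [id, Pi.pow_apply]
    field_simp
    norm_num
  refine ((hsqrt.pow n).inv (pow_ne_zero n hr)).congr_deriv ?_
  rcases n with _ | n
  · simp
  · simp only [Nat.add_sub_cancel, Pi.pow_apply]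
    field_simp
    ring

/-- The factor `W` in the factorization `∂V/∂q₂ = q₂ · W`. -/
noncomputable def verticalFactor (μ x b : ℝ) : ℝ :=
  μ * (√((x - (1 - μ)) ^ 2 + b ^ 2) ^ 3)⁻¹ + (1 - μ) * (√((x + μ) ^ 2 + b ^ 2) ^ 3)⁻¹ - 1

lemma hasDerivAt_V_snd (μ x : ℝ) {b : ℝ} (hb : b ≠ 0) :
    HasDerivAt (fun t => V μ (x, t)) (b * verticalFactor μ x b) b := by
  have he := hasDerivAt_inv_sqrt_sq_add_sq_pow (x - (1 - μ)) hb 1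
  have hs := hasDerivAt_inv_sqrt_sq_add_sq_pow (x + μ) hb 1
  have hq := (((hasDerivAt_id b).pow 2).const_add (x ^ 2)).div_const 2
  have hV : (fun t => V μ (x, t)) = fun t =>
      -μ * (√((x - (1 - μ)) ^ 2 + t ^ 2) ^ 1)⁻¹ - (1 - μ) * (√((x + μ) ^ 2 + t ^ 2) ^ 1)⁻¹
        - (x ^ 2 + t ^ 2) / 2 := by
    ext t
    simp [V, div_eq_mul_inv]
  rw [hV]
  refine (((he.const_mul (-μ)).sub (hs.const_mul (1 - μ))).sub hq).congr_deriv ?_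
  simp only [verticalFactor, id]
  push_cast
  ring

lemma hasDerivAt_verticalFactor (μ x : ℝ) {b : ℝ} (hb : b ≠ 0) :
    HasDerivAt (verticalFactor μ x)
      (-(3 * b * (μ * (√((x - (1 - μ)) ^ 2 + b ^ 2) ^ 5)⁻¹
        + (1 - μ) * (√((x + μ) ^ 2 + b ^ 2) ^ 5)⁻¹))) b := by
  have he := hasDerivAt_inv_sqrt_sq_add_sq_pow (x - (1 - μ)) hb 3
  have hs := hasDerivAt_inv_sqrt_sq_add_sq_pow (x + μ) hb 3
  refine (((he.const_mul μ).add (hs.const_mul (1 - μ))).sub_const 1).congr_deriv ?_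
  push_cast
  ring

/-- Away from the `q₁`-axis there is no vertical point of inflexion of the oval of zero
velocity: if `∂V/∂q₂` vanishes at a point with `q₂ ≠ 0`, then `∂²V/∂q₂²` does not. -/
theorem no_vertical_inflexion_off_axis (μ : ℝ) (hμ : μ ∈ Ioo (0 : ℝ) 1)
    (q : ℝ × ℝ) (he : q ≠ (1 - μ, 0)) (hs : q ≠ (-μ, 0)) (hq2 : q.2 ≠ 0)
    (hV : Vq2 μ q = 0) :
    Vq2q2 μ q ≠ 0 := by
  obtain ⟨x, b⟩ := q
  obtain ⟨hμ0, hμ1⟩ := hμ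
  change b ≠ 0 at hq2
  have hW : verticalFactor μ x b = 0 := by
    have h : b * verticalFactor μ x b = 0 := (hasDerivAt_V_snd μ x hq2).deriv.symm.trans hV
    exact (mul_eq_zero.1 h).resolve_left hq2
  have hderiv : deriv (fun t => V μ (x, t)) =ᶠ[nhds b] fun t => t * verticalFactor μ x t :=
    (eventually_ne_nhds hq2).mono fun t ht => (hasDerivAt_V_snd μ x ht).deriv
  have hsecond := ((hasDerivAt_id b).mul (hasDerivAt_verticalFactor μ x hq2)).deriv
  have hμ1' : 0 < 1 - μ := sub_pos.2 hμ1
  have hpos : 0 < 3 * b ^ 2 * (μ * (√((x - (1 - μ)) ^ 2 + b ^ 2) ^ 5)⁻¹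
      + (1 - μ) * (√((x + μ) ^ 2 + b ^ 2) ^ 5)⁻¹) := by positivity
  refine ne_of_lt ?_
  change deriv (deriv fun t => V μ (x, t)) b < 0
  rw [hderiv.deriv_eq]
  refine hsecond.trans_lt ?_
  rw [hW, id]
  linarith
end

section
/- Let μ ∈ (0,1) and let q₁ ∈ ℝ ∖ {-μ, 1-μ} satisfy W(q₁, 0) = 0, i.e., μ/|q₁-(1-μ)|³ + (1-μ)/|q₁+μ|³ = 1. Then: (a) if q₁ > 1-μ, then u'(q₁) = (1-μ)(1/(q₁+μ)³ - 1) < 0; (b) if q₁ < -μ, then u'(q₁) = -μ(1/|q₁-(1-μ)|³ - 1) > 0. (A vertical point of inflexion of the oval of zero velocity on the q₁-axis outside the primaries forces u to be strictly decreasing to the right of the earth, respectively strictly increasing to the left of the sun.) -/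
open Real Set

theorem hasDerivAt_inv_abs_sub {a x : ℝ} (h : x ≠ a) :
    HasDerivAt (fun y => |y - a|⁻¹) (-((x - a) / |x - a| ^ 3)) x := by
  have hx : x - a ≠ 0 := sub_ne_zero.mpr h
  have hd : HasDerivAt (fun y => |y - a|) (SignType.sign (x - a) : ℝ) x :=
    (hasDerivAt_abs hx).comp_sub_const x a
  refine (hd.fun_inv (abs_ne_zero.mpr hx)).congr_deriv ?_
  rcases lt_or_gt_of_ne hx with hneg | hpos
  · rw [sign_neg hneg, abs_of_neg hneg, SignType.coe_neg_one]
    field_simp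
  · rw [sign_pos hpos, abs_of_pos hpos, SignType.coe_one]
    field_simp

/-- The derivative of `u` away from the primaries, with the two summands of `W` isolated. -/
theorem deriv_u {μ x : ℝ} (hs : x ≠ -μ) (he : x ≠ 1 - μ) :
    deriv (u μ) x =
      (x - (1 - μ)) * (μ / |x - (1 - μ)| ^ 3) + (x + μ) * ((1 - μ) / |x + μ| ^ 3) - x := by
  have h := (((hasDerivAt_inv_abs_sub he).const_mul (-μ)).sub
    ((hasDerivAt_inv_abs_sub hs).const_mul (1 - μ))).sub ((hasDerivAt_pow 2 x).div_const 2)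
  have hu := h.congr_of_eventuallyEq (f₁ := u μ)
    (Filter.Eventually.of_forall fun y => by simp [u, div_eq_mul_inv])
  rw [hu.deriv, sub_neg_eq_add]
  push_cast
  ring

/-- If `W(q₁,0) = 0`, i.e. `μ/|q₁-(1-μ)|³ + (1-μ)/|q₁+μ|³ = 1`, then:
(a) for `q₁ > 1-μ`, `u'(q₁) = (1-μ)(1/(q₁+μ)³ - 1) < 0`;
(b) for `q₁ < -μ`, `u'(q₁) = -μ(1/|q₁-(1-μ)|³ - 1) > 0`. -/
theorem vertical_inflexion_on_axis (μ : ℝ) (hμ : μ ∈ Ioo (0 : ℝ) 1)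
    (q₁ : ℝ) (hs : q₁ ≠ -μ) (he : q₁ ≠ 1 - μ)
    (hW : μ / |q₁ - (1 - μ)| ^ 3 + (1 - μ) / |q₁ + μ| ^ 3 = 1) :
    (q₁ > 1 - μ →
      deriv (u μ) q₁ = (1 - μ) * (1 / (q₁ + μ) ^ 3 - 1) ∧ deriv (u μ) q₁ < 0)
    ∧ (q₁ < -μ →
      deriv (u μ) q₁ = -μ * (1 / |q₁ - (1 - μ)| ^ 3 - 1) ∧ deriv (u μ) q₁ > 0) := by
  obtain ⟨hμ₀, hμ₁⟩ := hμ
  have hd := deriv_u hs he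
  constructor
  · intro hq
    have hpos : 0 < q₁ + μ := by linarith
    rw [abs_of_pos hpos] at hW hd
    have hval : deriv (u μ) q₁ = (1 - μ) * (1 / (q₁ + μ) ^ 3 - 1) := by
      rw [hd]
      linear_combination (q₁ - (1 - μ)) * hW
    refine ⟨hval, ?_⟩
    have hlt : 1 / (q₁ + μ) ^ 3 < 1 := by
      rw [div_lt_one (by positivity)]
      exact one_lt_pow₀ (by linarith) (by norm_num)
    rw [hval]
    exact mul_neg_of_pos_of_neg (by linarith) (by linarith)
  · intro hq
    have hdist : 1 < |q₁ - (1 - μ)| := by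
      rw [abs_of_neg (by linarith)]
      linarith
    have hval : deriv (u μ) q₁ = -μ * (1 / |q₁ - (1 - μ)| ^ 3 - 1) := by
      rw [hd]
      linear_combination (q₁ + μ) * hW
    refine ⟨hval, ?_⟩
    have hlt : 1 / |q₁ - (1 - μ)| ^ 3 < 1 := by
      rw [div_lt_one (by positivity)]
      exact one_lt_pow₀ hdist (by norm_num)
    rw [hval]
    exact mul_pos_of_neg_of_neg (by linarith) (by linarith)
end

section
/- Let V_H(q) = -1/‖q‖ - (3/2)q₁² on ℝ² ∖ {0} be the effective potential of Hill's lunar problem. Suppose x : ℝ → ℝ² ∖ {0} is smooth and T-periodic for some T > 0, and satisfies Hill's equations of motion x₁'' = 2x₂' - x₁/‖x‖³ + 3x₁ and x₂'' = -2x₁' - x₂/‖x‖³. Then there exist t₀, t₁ ∈ [0, T) with t₀ ≠ t₁ such that x₂(t₀) = 0 and x₂(t₁) = 0; i.e., every periodic orbit of Hill's lunar problem has at least two distinct syzygies per period. -/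
open Real Set

/-- Along a periodic orbit of Hill's problem, `x₂' + 2 x₁` is periodic with derivative
`-x₂ / ‖x‖³`, so by Rolle's theorem a syzygy occurs strictly inside every window of length `T`. -/
theorem exists_syzygy_mem_Ioo
    (x : ℝ → ℝ × ℝ) (hsmooth : ContDiff ℝ 2 x)
    (T : ℝ) (hT : 0 < T) (hper : Function.Periodic x T)
    (heom2 : ∀ t, deriv (deriv fun s => (x s).2) t
      = -2 * deriv (fun s => (x s).1) t
        - (x t).2 / Real.sqrt ((x t).1 ^ 2 + (x t).2 ^ 2) ^ 3) (a : ℝ) :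
    ∃ c ∈ Ioo a (a + T), (x c).2 = 0 := by
  have hfst : Differentiable ℝ fun s => (x s).1 := hsmooth.fst.differentiable (by norm_num)
  have hsnd : Differentiable ℝ (deriv fun s => (x s).2) :=
    (ContDiff.deriv' (n := 1) (hsmooth.snd.of_le (by norm_num))).differentiable (by norm_num)
  have hderiv : ∀ t, HasDerivAt (fun s => deriv (fun s => (x s).2) s + 2 * (x s).1)
      (-((x t).2 / Real.sqrt ((x t).1 ^ 2 + (x t).2 ^ 2) ^ 3)) t := fun t => by
    refine ((hsnd t).hasDerivAt.add ((hfst t).hasDerivAt.const_mul 2)).congr_deriv ?_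
    rw [heom2]
    ring
  have hends : deriv (fun s => (x s).2) a + 2 * (x a).1
      = deriv (fun s => (x s).2) (a + T) + 2 * (x (a + T)).1 := by
    rw [← deriv_comp_add_const]
    simp only [hper _]
  obtain ⟨c, hc, hzero⟩ := exists_hasDerivAt_eq_zero (lt_add_of_pos_right a hT)
    (fun t _ => (hderiv t).continuousAt.continuousWithinAt) hends (fun t _ => hderiv t)
  refine ⟨c, hc, ?_⟩
  rcases div_eq_zero_iff.mp (neg_eq_zero.mp hzero) with h | h
  · exact h
  · have hnorm := (Real.sqrt_eq_zero (by positivity)).mp (pow_eq_zero_iff three_ne_zero |>.mp h)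
    nlinarith [sq_nonneg (x c).1, sq_nonneg (x c).2]

/-- Every periodic orbit of Hill's lunar problem has at least two distinct syzygies
per period. -/
theorem hill_syzygies
    (x : ℝ → ℝ × ℝ) (hsmooth : ContDiff ℝ (⊤ : ℕ∞) x)
    (hne : ∀ t, x t ≠ (0, 0))
    (T : ℝ) (hT : 0 < T) (hper : Function.Periodic x T)
    (heom1 : ∀ t, deriv (deriv fun s => (x s).1) t
      = 2 * deriv (fun s => (x s).2) t
        - (x t).1 / Real.sqrt ((x t).1 ^ 2 + (x t).2 ^ 2) ^ 3 + 3 * (x t).1)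
    (heom2 : ∀ t, deriv (deriv fun s => (x s).2) t
      = -2 * deriv (fun s => (x s).1) t
        - (x t).2 / Real.sqrt ((x t).1 ^ 2 + (x t).2 ^ 2) ^ 3) :
    ∃ t₀ ∈ Ico (0 : ℝ) T, ∃ t₁ ∈ Ico (0 : ℝ) T,
      t₀ ≠ t₁ ∧ (x t₀).2 = 0 ∧ (x t₁).2 = 0 := by
  have hsyz := exists_syzygy_mem_Ioo x (contDiff_infty.mp hsmooth 2) T hT hper heom2
  obtain ⟨c, ⟨hc0, hcT⟩, hc⟩ := hsyz 0
  obtain ⟨d, ⟨hcd, hdT⟩, hd⟩ := hsyz c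
  rw [zero_add] at hcT
  refine ⟨c, ⟨hc0.le, hcT⟩, ?_⟩
  rcases lt_or_ge d T with h | h
  · exact ⟨d, ⟨(hc0.trans hcd).le, h⟩, hcd.ne, hc, hd⟩
  · refine ⟨d - T, ⟨by linarith, by linarith⟩, (sub_lt_iff_lt_add.mpr hdT).ne',
      hc, ?_⟩
    rw [hper.sub_eq, hd]
end

section
/- The critical points of the effective potential V_H(q) = -1/‖q‖ - (3/2)q₁² of Hill's lunar problem on ℝ² ∖ {0} are exactly the two points (3^{-1/3}, 0) and (-3^{-1/3}, 0), and at both points V_H takes the value -3^{4/3}/2. -/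
open Real Set

/-- The effective potential of Hill's lunar problem. -/
noncomputable def VH (q : ℝ × ℝ) : ℝ :=
  -1 / Real.sqrt (q.1 ^ 2 + q.2 ^ 2) - 3 / 2 * q.1 ^ 2

/-- Partial derivative `∂V_H/∂q₁`. -/
noncomputable def VHq1 (q : ℝ × ℝ) : ℝ := deriv (fun a => VH (a, q.2)) q.1

/-- Partial derivative `∂V_H/∂q₂`. -/
noncomputable def VHq2 (q : ℝ × ℝ) : ℝ := deriv (fun b => VH (q.1, b)) q.2

/-- The derivative of `s ↦ -1 / √(s ^ 2 + t ^ 2)` away from the origin. -/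
lemma hasDerivAt_neg_one_div_sqrt {s t : ℝ} (h : 0 < s ^ 2 + t ^ 2) :
    HasDerivAt (fun a : ℝ => -1 / √(a ^ 2 + t ^ 2)) (s / √(s ^ 2 + t ^ 2) ^ 3) s := by
  have hr : √(s ^ 2 + t ^ 2) ≠ 0 := (Real.sqrt_pos.2 h).ne'
  have hsq : HasDerivAt (fun a : ℝ => a ^ 2 + t ^ 2) (2 * s) s := by
    simpa using (hasDerivAt_pow 2 s).add_const (t ^ 2)
  refine ((hasDerivAt_const s (-1 : ℝ)).fun_div (hsq.sqrt h.ne') hr).congr_deriv ?_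
  field_simp
  ring

lemma VHq1_eq {q : ℝ × ℝ} (h : 0 < q.1 ^ 2 + q.2 ^ 2) :
    VHq1 q = q.1 / √(q.1 ^ 2 + q.2 ^ 2) ^ 3 - 3 * q.1 := by
  refine HasDerivAt.deriv ?_
  refine ((hasDerivAt_neg_one_div_sqrt h).fun_sub
    ((hasDerivAt_pow 2 q.1).const_mul (3 / 2))).congr_deriv ?_
  push_cast
  ring

lemma VHq2_eq {q : ℝ × ℝ} (h : 0 < q.1 ^ 2 + q.2 ^ 2) :
    VHq2 q = q.2 / √(q.1 ^ 2 + q.2 ^ 2) ^ 3 := by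
  have h' : 0 < q.2 ^ 2 + q.1 ^ 2 := by rwa [add_comm]
  refine HasDerivAt.deriv ?_
  have := (hasDerivAt_neg_one_div_sqrt h').sub_const (3 / 2 * q.1 ^ 2)
  simpa only [VH, add_comm] using this

lemma VH_fst_zero (x : ℝ) : VH (x, 0) = -1 / |x| - 3 / 2 * x ^ 2 := by
  simp [VH, Real.sqrt_sq_eq_abs]

lemma three_rpow_neg_third_pow_three : ((3 : ℝ) ^ (-(1 / 3) : ℝ)) ^ 3 = 1 / 3 := by
  rw [← Real.rpow_natCast, ← Real.rpow_mul (by norm_num)]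
  norm_num [Real.rpow_neg_one]

lemma three_rpow_four_thirds : (3 : ℝ) ^ ((4 / 3) : ℝ) = 3 / (3 : ℝ) ^ (-(1 / 3) : ℝ) := by
  rw [show (4 / 3 : ℝ) = 1 - -(1 / 3) by norm_num, Real.rpow_sub (by norm_num), Real.rpow_one]

/-- The critical points are the points `(x, 0)` with `|x| ^ 3 = 1 / 3`. -/
lemma VHq1_eq_zero_and_VHq2_eq_zero_iff {q : ℝ × ℝ} (hq : q ≠ (0, 0)) :
    (VHq1 q = 0 ∧ VHq2 q = 0) ↔ |q.1| ^ 3 = 1 / 3 ∧ q.2 = 0 := by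
  obtain ⟨x, y⟩ := q
  have h : 0 < x ^ 2 + y ^ 2 := by
    by_contra! hle
    exact hq (Prod.ext (by nlinarith [sq_nonneg x, sq_nonneg y])
      (by nlinarith [sq_nonneg x, sq_nonneg y]))
  have hr : √(x ^ 2 + y ^ 2) ^ 3 ≠ 0 := pow_ne_zero 3 (Real.sqrt_pos.2 h).ne'
  rw [VHq1_eq h, VHq2_eq h, div_eq_zero_iff, or_iff_left hr]
  refine and_congr_left fun hy => ?_
  dsimp only at hy ⊢
  subst hy
  have hx : x ≠ 0 := by
    rintro rfl
    exact hq rfl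
  have hx' : |x| ≠ 0 := abs_ne_zero.2 hx
  rw [zero_pow two_ne_zero, add_zero, Real.sqrt_sq_eq_abs, sub_eq_zero,
    div_eq_iff (pow_ne_zero 3 hx')]
  constructor
  · intro h
    have : x * (3 * |x| ^ 3 - 1) = 0 := by linarith
    rcases mul_eq_zero.1 this with h | h
    · exact absurd h hx
    · linarith
  · intro h
    rw [h]
    ring

/-- The critical points of the effective potential of Hill's lunar problem are exactly
`(±3^{-1/3}, 0)`, and at both points `V_H` takes the value `-3^{4/3}/2`. -/
theorem hill_critical_points :
    (∀ q : ℝ × ℝ, q ≠ (0, 0) →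
      ((VHq1 q = 0 ∧ VHq2 q = 0) ↔
        (q = ((3 : ℝ) ^ (-(1 / 3) : ℝ), 0) ∨ q = (-(3 : ℝ) ^ (-(1 / 3) : ℝ), 0))))
    ∧ VH ((3 : ℝ) ^ (-(1 / 3) : ℝ), 0) = -(3 : ℝ) ^ ((4 / 3) : ℝ) / 2
    ∧ VH (-(3 : ℝ) ^ (-(1 / 3) : ℝ), 0) = -(3 : ℝ) ^ ((4 / 3) : ℝ) / 2 := by
  have hc : 0 < (3 : ℝ) ^ (-(1 / 3) : ℝ) := Real.rpow_pos_of_pos (by norm_num) _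
  have hc3 := three_rpow_neg_third_pow_three
  rw [three_rpow_four_thirds]
  generalize (3 : ℝ) ^ (-(1 / 3) : ℝ) = c at hc hc3
  have hval : -1 / c - 3 / 2 * c ^ 2 = -(3 / c) / 2 := by
    field_simp
    linarith
  refine ⟨fun q hq => ?_, ?_, ?_⟩
  · rw [VHq1_eq_zero_and_VHq2_eq_zero_iff hq, ← hc3,
      pow_left_inj₀ (abs_nonneg _) hc.le three_ne_zero, abs_eq hc.le, Prod.ext_iff, Prod.ext_iff,
      or_and_right]
  · rw [VH_fst_zero, abs_of_pos hc, hval]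
  · rw [VH_fst_zero, abs_neg, abs_of_pos hc, neg_sq, hval]
end

section
/- Let c < -3^{4/3}/2. Then the connected component of the Hill's region {q ∈ ℝ² ∖ {0} : V_H(q) ≤ c} of Hill's lunar problem whose closure contains the origin is contained in the open ball of radius 3^{-1/3} centered at the origin. -/
open Real Set

/-- On the circle of radius `3^{-1/3}` the potential is at least the critical value. -/
theorem critical_value_le_VH {q : ℝ × ℝ}
    (hq : √(q.1 ^ 2 + q.2 ^ 2) = (3 : ℝ) ^ (-(1 / 3) : ℝ)) :
    -(3 : ℝ) ^ ((4 / 3) : ℝ) / 2 ≤ VH q := by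
  obtain ⟨a, ha⟩ : ∃ a : ℝ, a = (3 : ℝ) ^ ((1 / 3) : ℝ) := ⟨_, rfl⟩
  have ha0 : 0 < a := ha ▸ by positivity
  have ha3 : a ^ 3 = 3 := by
    rw [ha, ← Real.rpow_natCast, ← Real.rpow_mul (by norm_num)]
    norm_num
  have h43 : (3 : ℝ) ^ ((4 / 3) : ℝ) = 3 * a := by
    rw [ha, show (4 / 3 : ℝ) = 1 + 1 / 3 by norm_num, Real.rpow_add (by norm_num),
      Real.rpow_one]
  rw [Real.rpow_neg (by norm_num), ← ha] at hq
  have hsq : q.1 ^ 2 + q.2 ^ 2 = (a⁻¹) ^ 2 := by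
    rw [← hq, Real.sq_sqrt (by positivity)]
  have hinv : 3 * (a⁻¹) ^ 2 = a := by
    field_simp
    exact ha3.symm
  rw [VH, hq, h43, div_inv_eq_mul]
  nlinarith [sq_nonneg q.2]

/-- For any energy `c` below the critical value `-3^{4/3}/2`, the bounded component of
the Hill's region of Hill's lunar problem (the connected component of
`{V_H ≤ c}` whose closure contains the origin) is contained in the open Euclidean ball
of radius `3^{-1/3}` around the origin. -/
theorem hill_bounded_region_in_ball
    (c : ℝ) (hc : c < -(3 : ℝ) ^ ((4 / 3) : ℝ) / 2)
    (K : Set (ℝ × ℝ)) (p : ℝ × ℝ)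
    (hK : K = connectedComponentIn {q : ℝ × ℝ | q ≠ (0, 0) ∧ VH q ≤ c} p)
    (hK0 : ((0, 0) : ℝ × ℝ) ∈ closure K) :
    K ⊆ {q : ℝ × ℝ | Real.sqrt (q.1 ^ 2 + q.2 ^ 2) < (3 : ℝ) ^ (-(1 / 3) : ℝ)} := by
  intro q hq
  rw [mem_ofPred_eq]
  by_contra! hge
  have hcont : Continuous fun x : ℝ × ℝ => √(x.1 ^ 2 + x.2 ^ 2) := by fun_prop
  have hr : (0 : ℝ) < (3 : ℝ) ^ (-(1 / 3) : ℝ) := by positivity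
  obtain ⟨z, hz, hzK⟩ := mem_closure_iff.1 hK0 _ (isOpen_Iio.preimage hcont)
    (show √((0 : ℝ) ^ 2 + 0 ^ 2) < (3 : ℝ) ^ (-(1 / 3) : ℝ) by simpa using hr)
  have hpre : IsPreconnected K := hK ▸ isPreconnected_connectedComponentIn
  obtain ⟨w, hwK, hw⟩ := hpre.intermediate_value hzK hq hcont.continuousOn
    ⟨(mem_Iio.1 hz).le, hge⟩
  rw [hK] at hwK
  have hwc : VH w ≤ c := (connectedComponentIn_subset _ _ hwK).2
  linarith [critical_value_le_VH hw]
end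

section
/- Let f : ℝ × ℝ → ℝ be smooth with f(r, x + 2π) = f(r, x) for all r, x (a smooth 1-parameter family of functions on the circle). Suppose each f_r := f(r, ·) is Morse, i.e., for all r and x, ∂f/∂x(r,x) = 0 implies ∂²f/∂x²(r,x) ≠ 0. Then for every r the set {x ∈ [0, 2π) : ∂f/∂x(r,x) = 0} is finite, and its cardinality is independent of r. -/
open Real Set

open Filter Topology

section FiniteFibers

variable {R X : Type*} [TopologicalSpace R] [TopologicalSpace X] [CompactSpace X]
  {Z : R → Set X}

theorem finite_fiber_of_isolated (hclosed : IsClosed {p : R × X | p.2 ∈ Z p.1})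
    (hunique : ∀ r, ∀ x ∈ Z r, ∃ V ∈ 𝓝 x, ∀ᶠ s in 𝓝 r, (V ∩ Z s).Subsingleton) (r : R) :
    (Z r).Finite := by
  have hcompact : IsCompact (Z r) :=
    (hclosed.preimage (Continuous.prodMk_right r)).isCompact
  choose! V hV hVunique using hunique r
  obtain ⟨t, ht, hcover⟩ := hcompact.elim_nhds_subcover V hV
  refine (t.finite_toSet.biUnion fun x hx =>
    (hVunique x (ht x hx)).self_of_nhds.finite).subset fun y hy => ?_
  obtain ⟨x, hx, hyx⟩ := mem_iUnion₂.1 (hcover hy)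
  exact mem_iUnion₂.2 ⟨x, hx, hyx, hy⟩

/-- If a closed family of subsets of a compact Hausdorff space meets small neighborhoods of each
of its points exactly once, stably in the parameter, then the cardinality of its members is locally
constant. -/
theorem isLocallyConstant_ncard_fiber [T2Space X]
    (hclosed : IsClosed {p : R × X | p.2 ∈ Z p.1})
    (hunique : ∀ r, ∀ x ∈ Z r, ∃ V ∈ 𝓝 x, ∀ᶠ s in 𝓝 r, (V ∩ Z s).Subsingleton)
    (hexists : ∀ r, ∀ x ∈ Z r, ∀ V ∈ 𝓝 x, ∀ᶠ s in 𝓝 r, (V ∩ Z s).Nonempty) :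
    IsLocallyConstant fun r => (Z r).ncard := by
  refine (IsLocallyConstant.iff_eventually_eq _).2 fun r => ?_
  have hfin := finite_fiber_of_isolated hclosed hunique r
  obtain ⟨U, hU, hdisj⟩ := hfin.t2_separation
  choose! V hV hVunique using hunique r
  have hW : ∀ x ∈ Z r, U x ∩ V x ∈ 𝓝 x := fun x hx =>
    inter_mem ((hU x).2.mem_nhds (hU x).1) (hV x hx)
  have hcover : ∀ᶠ s in 𝓝 r, ∀ y ∈ (⋃ x ∈ Z r, interior (U x ∩ V x))ᶜ, y ∉ Z s := by
    refine (isOpen_biUnion fun _ _ => isOpen_interior).isClosed_compl.isCompact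
      |>.eventually_forall_of_forall_eventually (P := fun s y => y ∉ Z s) fun y hy => ?_
    refine hclosed.isOpen_compl.mem_nhds fun hyr => hy ?_
    exact mem_iUnion₂.2 ⟨y, hyr, mem_interior_iff_mem_nhds.2 (hW y hyr)⟩
  have hsub := (eventually_all_finite hfin).2 hVunique
  have hne := (eventually_all_finite hfin).2 fun x hx => hexists r x hx _ (hW x hx)
  filter_upwards [hcover, hsub, hne] with s hcover hsub hne
  choose! φ hφ using hne
  have hinj : InjOn φ (Z r) := fun x hx y hy hxy =>
    hdisj.elim_set hx hy (φ x) (hφ x hx).1.1 (hxy ▸ (hφ y hy).1.1)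
  have himage : φ '' Z r = Z s := by
    refine (image_subset_iff.2 fun x hx => (hφ x hx).2).antisymm fun y hy => ?_
    obtain ⟨x, hx, hyx⟩ := mem_iUnion₂.1 (not_not.1 fun h => hcover y h hy)
    exact ⟨x, hx, hsub x hx ⟨(hφ x hx).1.2, (hφ x hx).2⟩ ⟨(interior_subset hyx).2, hy⟩⟩
  rw [← himage, hinj.ncard_image]

end FiniteFibers

section SimpleZeros

variable {R : Type*} [TopologicalSpace R] {g : R → ℝ → ℝ}

theorem eventually_exists_zero_of_deriv_pos (hg : Continuous fun p : R × ℝ => g p.1 p.2)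
    {r : R} {x : ℝ} (hx : g r x = 0) (hderiv : 0 < deriv (g r) x) {W : Set ℝ} (hW : W ∈ 𝓝 x) :
    ∀ᶠ s in 𝓝 r, ∃ y ∈ W, g s y = 0 := by
  obtain ⟨ε, hε, hball⟩ := Metric.eventually_nhds_iff_ball.1
    ((eventually_nhdsWithin_sign_eq_of_deriv_pos hderiv hx).and hW)
  have hmem : ∀ y ∈ Icc (x - ε / 2) (x + ε / 2), y ∈ Metric.ball x ε := fun y hy => by
    rw [Metric.mem_ball, Real.dist_eq, abs_lt]
    constructor <;> linarith [hy.1, hy.2]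
  have hle : x - ε / 2 ≤ x + ε / 2 := by linarith
  have hneg : g r (x - ε / 2) < 0 := by
    rw [← sign_eq_neg_one_iff, (hball _ (hmem _ (left_mem_Icc.2 hle))).1, sign_eq_neg_one_iff]
    linarith
  have hpos : 0 < g r (x + ε / 2) := by
    rw [← sign_eq_one_iff, (hball _ (hmem _ (right_mem_Icc.2 hle))).1, sign_eq_one_iff]
    linarith
  have hcont : ∀ y, Continuous fun s => g s y := fun y => hg.comp (Continuous.prodMk_left y)
  filter_upwards [(hcont _).continuousAt.eventually_lt_const hneg,
    (hcont _).continuousAt.eventually_const_lt hpos] with s hs₁ hs₂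
  obtain ⟨y, hy, hys⟩ := intermediate_value_Icc hle
    (hg.comp (Continuous.prodMk_right s)).continuousOn ⟨hs₁.le, hs₂.le⟩
  exact ⟨y, (hball y (hmem y hy)).2, hys⟩

/-- A simple zero persists under small continuous perturbations. -/
theorem eventually_exists_zero_of_deriv_ne_zero (hg : Continuous fun p : R × ℝ => g p.1 p.2)
    {r : R} {x : ℝ} (hx : g r x = 0) (hderiv : deriv (g r) x ≠ 0) {W : Set ℝ} (hW : W ∈ 𝓝 x) :
    ∀ᶠ s in 𝓝 r, ∃ y ∈ W, g s y = 0 := by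
  rcases hderiv.lt_or_gt with h | h
  · have := eventually_exists_zero_of_deriv_pos (g := fun s y => -g s y) hg.neg (r := r) (x := x)
      (by simpa using hx) (by simpa [deriv.fun_neg] using h) hW
    simpa using this
  · exact eventually_exists_zero_of_deriv_pos hg hx h hW

/-- A simple zero is locally the only one, uniformly under small `C¹` perturbations. -/
theorem exists_nhds_eventually_subsingleton_zeros (hg : ∀ s, Continuous (g s))
    (hg' : Continuous fun p : R × ℝ => deriv (g p.1) p.2)
    {r : R} {x : ℝ} (hderiv : deriv (g r) x ≠ 0) :
    ∃ W ∈ 𝓝 x, ∀ᶠ s in 𝓝 r, (W ∩ {y | g s y = 0}).Subsingleton := by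
  have hne : ∀ᶠ p in 𝓝 r ×ˢ 𝓝 x, deriv (g p.1) p.2 ≠ 0 := by
    rw [← nhds_prod_eq]
    exact hg'.continuousAt.eventually_ne hderiv
  obtain ⟨P, hP, Q, hQ, hPQ⟩ := eventually_prod_iff.1 hne
  obtain ⟨ε, hε, hball⟩ := Metric.eventually_nhds_iff_ball.1 hQ
  refine ⟨Metric.ball x ε, Metric.ball_mem_nhds x hε, hP.mono fun s hs => ?_⟩
  have hlt : ∀ y ∈ Metric.ball x ε, ∀ z ∈ Metric.ball x ε, g s y = 0 → g s z = 0 → ¬ y < z := by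
    intro y hy z hz hy0 hz0 hyz
    obtain ⟨c, hc, hc0⟩ := exists_deriv_eq_zero hyz (hg s).continuousOn (hy0.trans hz0.symm)
    exact hPQ hs (hball c ((convex_ball x ε).ordConnected.out hy hz (Ioo_subset_Icc_self hc))) hc0
  rintro y ⟨hy, hy0⟩ z ⟨hz, hz0⟩
  exact le_antisymm (not_lt.1 (hlt z hz y hy hz0 hy0)) (not_lt.1 (hlt y hy z hz hy0 hz0))

end SimpleZeros

/-- In a continuous family of `C¹` periodic functions with only simple zeros, the number of zeros
in a period is finite and locally constant. -/
theorem finite_and_isLocallyConstant_ncard_zeros {R : Type*} [TopologicalSpace R]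
    {g : R → ℝ → ℝ} {T : ℝ} (hT : 0 < T) (hper : ∀ r, Function.Periodic (g r) T)
    (hg : Continuous fun p : R × ℝ => g p.1 p.2)
    (hg' : Continuous fun p : R × ℝ => deriv (g p.1) p.2)
    (hsimple : ∀ r x, g r x = 0 → deriv (g r) x ≠ 0) :
    (∀ r, {x ∈ Ico 0 T | g r x = 0}.Finite) ∧
      IsLocallyConstant fun r => {x ∈ Ico 0 T | g r x = 0}.ncard := by
  have : Fact (0 < T) := ⟨hT⟩
  have hmk : IsOpenQuotientMap ((↑) : ℝ → AddCircle T) := QuotientAddGroup.isOpenQuotientMap_mk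
  let Z : R → Set (AddCircle T) := fun r => {x | (hper r).lift x = 0}
  have hclosed : IsClosed {p : R × AddCircle T | p.2 ∈ Z p.1} :=
    (IsOpenQuotientMap.id.prodMap hmk).isQuotientMap.isClosed_preimage.1
      (isClosed_singleton.preimage hg)
  have hgs : ∀ s, Continuous (g s) := fun s => hg.comp (Continuous.prodMk_right s)
  have hunique : ∀ r, ∀ x ∈ Z r, ∃ V ∈ 𝓝 x, ∀ᶠ s in 𝓝 r, (V ∩ Z s).Subsingleton := by
    intro r x hx
    obtain ⟨x, rfl⟩ := hmk.surjective x
    obtain ⟨W, hW, hsub⟩ := exists_nhds_eventually_subsingleton_zeros hgs hg' (hsimple r x hx)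
    refine ⟨(↑) '' W, hmk.isOpenMap.image_mem_nhds hW, hsub.mono fun s hs => ?_⟩
    rintro _ ⟨⟨y, hy, rfl⟩, hy0⟩ _ ⟨⟨z, hz, rfl⟩, hz0⟩
    exact congrArg _ (hs ⟨hy, hy0⟩ ⟨hz, hz0⟩)
  have hexists : ∀ r, ∀ x ∈ Z r, ∀ V ∈ 𝓝 x, ∀ᶠ s in 𝓝 r, (V ∩ Z s).Nonempty := by
    intro r x hx V hV
    obtain ⟨x, rfl⟩ := hmk.surjective x
    refine (eventually_exists_zero_of_deriv_ne_zero hg hx (hsimple r x hx)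
      (hmk.continuous.continuousAt hV)).mono ?_
    rintro s ⟨y, hy, hy0⟩
    exact ⟨y, hy, hy0⟩
  have hinj : ∀ r, InjOn ((↑) : ℝ → AddCircle T) {x ∈ Ico 0 T | g r x = 0} := by
    intro r x hx y hy
    exact (AddCircle.coe_eq_coe_iff_of_mem_Ico (a := 0) (by simpa using hx.1)
      (by simpa using hy.1)).1
  have himage : ∀ r, ((↑) : ℝ → AddCircle T) '' {x ∈ Ico 0 T | g r x = 0} = Z r := by
    intro r
    ext x
    constructor
    · rintro ⟨x, hx, rfl⟩
      exact hx.2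
    · intro hx
      obtain ⟨y, hy, rfl⟩ := AddCircle.eq_coe_Ico x
      exact ⟨y, ⟨hy, hx⟩, rfl⟩
  refine ⟨fun r => Finite.of_finite_image ?_ (hinj r), ?_⟩
  · rw [himage]
    exact finite_fiber_of_isolated hclosed hunique r
  · convert isLocallyConstant_ncard_fiber hclosed hunique hexists using 2 with r
    rw [← himage, (hinj r).ncard_image]

theorem contDiff_deriv_snd {f : ℝ × ℝ → ℝ} (hf : ContDiff ℝ (⊤ : ℕ∞) f) :
    ContDiff ℝ (⊤ : ℕ∞) fun p : ℝ × ℝ => deriv (fun y => f (p.1, y)) p.2 := by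
  have heq : (fun p : ℝ × ℝ => deriv (fun y => f (p.1, y)) p.2) =
      fun p => fderiv ℝ f p (0, 1) := by
    ext ⟨r, x⟩
    have hfd : HasFDerivAt f (fderiv ℝ f (r, x)) (r, x) :=
      (hf.differentiable (by simp) (r, x)).hasFDerivAt
    exact (hfd.comp_hasDerivAt x ((hasDerivAt_const x r).prodMk (hasDerivAt_id x))).deriv
  rw [heq]
  exact (hf.fderiv_right (m := (⊤ : ℕ∞)) (by simp)).clm_apply contDiff_const

/-- In a smooth 1-parameter family of Morse functions on the circle (realized as smooth
`2π`-periodic functions of `x`), the number of critical points in a fundamental domain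
`[0, 2π)` is finite and independent of the parameter. -/
theorem morse_family_constant_critical_count
    (f : ℝ × ℝ → ℝ) (hsmooth : ContDiff ℝ (⊤ : ℕ∞) f)
    (hper : ∀ r x : ℝ, f (r, x + 2 * π) = f (r, x))
    (hmorse : ∀ r x : ℝ, deriv (fun y => f (r, y)) x = 0 →
      deriv (deriv fun y => f (r, y)) x ≠ 0) :
    (∀ r : ℝ, {x ∈ Ico 0 (2 * π) | deriv (fun y => f (r, y)) x = 0}.Finite)
    ∧ ∀ r₁ r₂ : ℝ,
      {x ∈ Ico 0 (2 * π) | deriv (fun y => f (r₁, y)) x = 0}.ncard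
        = {x ∈ Ico 0 (2 * π) | deriv (fun y => f (r₂, y)) x = 0}.ncard := by
  have hderiv := contDiff_deriv_snd hsmooth
  have hderivper : ∀ r, Function.Periodic (deriv fun y => f (r, y)) (2 * π) := fun r x => by
    rw [← deriv_comp_add_const]
    simp only [hper]
  obtain ⟨hfin, hconst⟩ := finite_and_isLocallyConstant_ncard_zeros
    (g := fun r => deriv fun y => f (r, y)) two_pi_pos hderivper hderiv.continuous
    (contDiff_deriv_snd hderiv).continuous hmorse
  exact ⟨hfin, hconst.apply_eq_of_preconnectedSpace⟩
end
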